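/- arXiv:1102.2998 — 3 statements merged into one kernel-verified Lean document; each statement's English description precedes it below -/
import Mathlib

section
/- Let d ≥ 1, let γ : [0,∞) → [0,∞) be strictly increasing and continuous with γ(0) = 0, let R > 0, and let φ : ℝ^d → ℝ be such that its radial derivatives φ'(rω) and φ''(rω) are continuous for r > R and satisfy conditions (i) and (ii). Let s < 0. Then there exists a measurable function g : ℝ^d → ℂ with ∫_{ℝ^d} ⟨ξ⟩^{s} |g(ξ)| dξ < ∞, and a function u, continuous on {(x,t) : x ∈ ℝ^d, t > 0}, such that for every x ∈ ℝ^d and t > 0 the truncated integrals (2π)^{-d} ∫_{|ξ|<R'} e^{i(x·ξ + tφ(ξ))} g(ξ) dξ converge to u(x,t) as R' → ∞, and such that for every x ∈ ℝ^d one has limsup |u(y,t)| = +∞, where the limit superior is taken over (y,t) → (x,0) with |y−x| < γ(t) and t > 0. -/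
open MeasureTheory Filter Metric Set
open scoped Topology ENNReal

lemma aux_oneD_pos (ψ ψ' : ℝ → ℝ) (N Λ ℓ : ℝ) (hΛ : 0 < Λ) (hℓ : 0 < ℓ)
    (hd : ∀ r, N ≤ r → HasDerivAt ψ (ψ' r) r) (hc : ContinuousOn ψ' (Ici N))
    (hpos : ∀ r, N ≤ r → Λ ≤ ψ' r) :
    ∃ b, N ≤ b ∧ b ≤ N + ℓ / Λ ∧ (∀ r, N ≤ r → (|ψ r - ψ N| ≤ ℓ ↔ r ≤ b)) ∧
      (∫ r in N..b, |ψ' r|) = ℓ ∧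
      ∀ c ∈ Icc N b, ∀ x τ : ℝ, τ ≠ 0 →
        ‖∫ r in N..c, ((|ψ' r| : ℝ) : ℂ) * Complex.exp (Complex.I * ((x * r + τ * ψ r : ℝ) : ℂ))‖
          ≤ 2 / |τ| + |x| * (ℓ / Λ) * ℓ := by
  have hcont : ContinuousOn ψ (Ici N) := fun r hr => (hd r hr).continuousAt.continuousWithinAt
  have hint : ∀ a b, N ≤ a → N ≤ b → IntervalIntegrable ψ' volume a b := fun a b ha hb =>
    (hc.mono (fun z hz => by
      rcases le_total a b with h | h
      · rw [uIcc_of_le h] at hz; exact ha.trans hz.1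
      · rw [uIcc_of_ge h] at hz; exact hb.trans hz.1)).intervalIntegrable
  have hFTC : ∀ b, N ≤ b → (∫ r in N..b, ψ' r) = ψ b - ψ N := fun b hb =>
    intervalIntegral.integral_eq_sub_of_hasDerivAt
      (fun r hr => hd r (by rw [uIcc_of_le hb] at hr; exact hr.1)) (hint _ _ le_rfl hb)
  have hmono : StrictMonoOn ψ (Ici N) := by
    apply strictMonoOn_of_deriv_pos (convex_Ici N) hcont
    intro r hr
    rw [interior_Ici] at hr
    rw [(hd r (le_of_lt hr)).deriv]
    exact hΛ.trans_le (hpos r (le_of_lt hr))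
  have hgrow : ∀ b, N ≤ b → Λ * (b - N) ≤ ψ b - ψ N := by
    intro b hb
    rw [← hFTC b hb]
    have := intervalIntegral.integral_mono_on (f := fun _ => Λ) (g := ψ') hb (by simp)
      (hint _ _ le_rfl hb) (fun r hr => hpos r hr.1)
    simpa [mul_comm] using this
  have hℓΛ : 0 < ℓ / Λ := div_pos hℓ hΛ
  obtain ⟨b, hb, hbe⟩ : ∃ b ∈ Icc N (N + ℓ / Λ), ψ b = ψ N + ℓ := by
    apply intermediate_value_Icc (by linarith) (hcont.mono Icc_subset_Ici_self)
    refine ⟨by linarith, ?_⟩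
    have := hgrow (N + ℓ / Λ) (by linarith)
    have h2 : Λ * (N + ℓ / Λ - N) = ℓ := by field_simp; ring
    linarith
  have habs : ∀ r, N ≤ r → |ψ' r| = ψ' r := fun r hr => abs_of_pos (hΛ.trans_le (hpos r hr))
  have hI : ∀ c, N ≤ c → (∫ r in N..c, |ψ' r|) = ψ c - ψ N := by
    intro c hc
    rw [← hFTC c hc]
    apply intervalIntegral.integral_congr
    intro r hr
    rw [uIcc_of_le hc] at hr
    exact habs r hr.1
  refine ⟨b, hb.1, hb.2, ?_, ?_, ?_⟩
  · intro r hr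
    have h0 : 0 ≤ ψ r - ψ N := by
      have := hmono.monotoneOn (mem_Ici.2 le_rfl) (mem_Ici.2 hr) hr
      linarith
    rw [abs_of_nonneg h0, ← hmono.le_iff_le (mem_Ici.2 hr) (mem_Ici.2 hb.1), hbe]
    constructor <;> intro h <;> linarith
  · rw [hI b hb.1, hbe]; ring
  · intro c hcb x τ hτ
    have hNc := hcb.1
    have hsub : uIcc N c ⊆ Ici N := by rw [uIcc_of_le hNc]; exact Icc_subset_Ici_self
    set F : ℝ → ℂ := fun r => ((|ψ' r| : ℝ) : ℂ) * Complex.exp (Complex.I * ((x * r + τ * ψ r : ℝ) : ℂ))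
    set G : ℝ → ℂ := fun r => ((ψ' r : ℝ) : ℂ) * Complex.exp (Complex.I * ((x * N + τ * ψ r : ℝ) : ℂ))
    have hFc : ContinuousOn F (Ici N) := by
      apply ContinuousOn.mul
      · exact Complex.continuous_ofReal.comp_continuousOn hc.abs
      · apply Complex.continuous_exp.comp_continuousOn
        apply ContinuousOn.mul continuousOn_const
        apply Complex.continuous_ofReal.comp_continuousOn
        fun_prop
    have hGc : ContinuousOn G (Ici N) := by
      apply ContinuousOn.mul
      · exact Complex.continuous_ofReal.comp_continuousOn hc
      · apply Complex.continuous_exp.comp_continuousOn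
        apply ContinuousOn.mul continuousOn_const
        apply Complex.continuous_ofReal.comp_continuousOn
        fun_prop
    have hFi : IntervalIntegrable F volume N c := (hFc.mono hsub).intervalIntegrable
    have hGi : IntervalIntegrable G volume N c := (hGc.mono hsub).intervalIntegrable
    have hG : ‖∫ r in N..c, G r‖ ≤ 2 / |τ| := by
      have hτ' : (Complex.I * (τ : ℂ)) ≠ 0 := mul_ne_zero Complex.I_ne_zero (by exact_mod_cast hτ)
      have : ∀ r ∈ uIcc N c, HasDerivAt (fun r => Complex.exp (Complex.I * ((x * N + τ * ψ r : ℝ) : ℂ)) / (Complex.I * τ)) (G r) r := by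
        intro r hr
        have h1 : HasDerivAt (fun r => ((x * N + τ * ψ r : ℝ) : ℂ)) ((τ * ψ' r : ℝ) : ℂ) r :=
          (((hd r (hsub hr)).const_mul τ).const_add (x * N)).ofReal_comp
        have h2 := ((h1.const_mul Complex.I).cexp).div_const (Complex.I * τ)
        refine h2.congr_deriv ?_
        change _ = ((ψ' r : ℝ) : ℂ) * Complex.exp (Complex.I * ((x * N + τ * ψ r : ℝ) : ℂ))
        rw [div_eq_iff hτ']
        push_cast
        ring
      rw [intervalIntegral.integral_eq_sub_of_hasDerivAt this hGi, ← sub_div, norm_div]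
      have hn : ‖Complex.I * (τ : ℂ)‖ = |τ| := by simp
      rw [hn]
      gcongr
      refine (norm_sub_le _ _).trans ?_
      rw [mul_comm Complex.I, mul_comm Complex.I, Complex.norm_exp_ofReal_mul_I, Complex.norm_exp_ofReal_mul_I]
      norm_num
    have hFG : ‖∫ r in N..c, (F r - G r)‖ ≤ |x| * (ℓ / Λ) * ℓ := by
      have hle : ∀ r ∈ Icc N c, ‖F r - G r‖ ≤ |x| * (ℓ / Λ) * |ψ' r| := by
        intro r hr
        have : F r - G r = ((ψ' r : ℝ) : ℂ) * (Complex.exp (Complex.I * ((x * N + τ * ψ r : ℝ) : ℂ)) * (Complex.exp (Complex.I * ((x * (r - N) : ℝ) : ℂ)) - 1)) := by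
          simp only [F, G, habs r hr.1]
          rw [mul_sub, ← Complex.exp_add, mul_one, ← mul_sub]
          congr 3
          push_cast; ring
        rw [this, norm_mul, norm_mul, mul_comm Complex.I, Complex.norm_exp_ofReal_mul_I, one_mul,
          mul_comm, Complex.norm_real, Real.norm_eq_abs]
        gcongr
        refine (Real.norm_exp_I_mul_ofReal_sub_one_le).trans ?_
        rw [Real.norm_eq_abs, abs_mul]
        gcongr
        rw [abs_of_nonneg (by linarith [hr.1])]
        linarith [hr.2, hcb.2, hb.2]
      calc _ ≤ ∫ r in N..c, |x| * (ℓ / Λ) * |ψ' r| := by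
            apply intervalIntegral.norm_integral_le_of_norm_le hNc
            · filter_upwards with r hr using hle r (Ioc_subset_Icc_self hr)
            · exact ((hint _ _ le_rfl hNc).abs).const_mul _
        _ = |x| * (ℓ / Λ) * (ψ c - ψ N) := by
            rw [intervalIntegral.integral_const_mul, hI c hNc]
        _ ≤ _ := by
            gcongr
            have := hmono.monotoneOn (mem_Ici.2 hNc) (mem_Ici.2 hb.1) hcb.2
            linarith
    rw [intervalIntegral.integral_sub hFi hGi] at hFG
    calc _ = ‖(∫ r in N..c, G r) + ((∫ r in N..c, F r) - ∫ r in N..c, G r)‖ := by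
          congr 1; ring
      _ ≤ _ := (norm_add_le _ _).trans (add_le_add hG hFG)

lemma aux_oneD (ψ ψ' : ℝ → ℝ) (N Λ ℓ : ℝ) (hΛ : 0 < Λ) (hℓ : 0 < ℓ)
    (hd : ∀ r, N ≤ r → HasDerivAt ψ (ψ' r) r) (hc : ContinuousOn ψ' (Ici N))
    (hpos : ∀ r, N ≤ r → Λ ≤ |ψ' r|) :
    ∃ b, N ≤ b ∧ b ≤ N + ℓ / Λ ∧ (∀ r, N ≤ r → (|ψ r - ψ N| ≤ ℓ ↔ r ≤ b)) ∧
      (∫ r in N..b, |ψ' r|) = ℓ ∧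
      ∀ c ∈ Icc N b, ∀ x τ : ℝ, τ ≠ 0 →
        ‖∫ r in N..c, ((|ψ' r| : ℝ) : ℂ) * Complex.exp (Complex.I * ((x * r + τ * ψ r : ℝ) : ℂ))‖
          ≤ 2 / |τ| + |x| * (ℓ / Λ) * ℓ := by
  have hne : ∀ r ∈ Ici N, ψ' r ≠ 0 := fun r hr h => by
    have := hpos r hr
    rw [h, abs_zero] at this
    linarith
  have hsign : (∀ r ∈ Ici N, 0 < ψ' r) ∨ (∀ r ∈ Ici N, ψ' r < 0) := by
    by_contra! hcon
    obtain ⟨⟨a, ha, ha'⟩, ⟨b, hb, hb'⟩⟩ := hcon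
    obtain ⟨z, hz, hz'⟩ := isPreconnected_Ici.intermediate_value ha hb hc (⟨ha', hb'⟩ : (0:ℝ) ∈ Icc _ _)
    exact hne z hz hz'
  rcases hsign with h | h
  · exact aux_oneD_pos ψ ψ' N Λ ℓ hΛ hℓ hd hc (fun r hr => by
      have := hpos r hr; rwa [abs_of_pos (h r hr)] at this)
  · obtain ⟨b, h1, h2, h3, h4, h5⟩ := aux_oneD_pos (fun r => -ψ r) (fun r => -ψ' r) N Λ ℓ hΛ hℓ
      (fun r hr => (hd r hr).neg) hc.neg (fun r hr => by
      have := hpos r hr; rwa [abs_of_neg (h r hr)] at this)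
    refine ⟨b, h1, h2, ?_, ?_, ?_⟩
    · intro r hr
      rw [← h3 r hr, ← abs_neg (ψ r - ψ N)]
      congr! 2
      ring
    · simpa using h4
    · intro c hcb x τ hτ
      have := h5 c hcb x (-τ) (by simpa using hτ)
      simpa using this

lemma aux_polar_map {E : Type*} [NormedAddCommGroup E] [NormedSpace ℝ E]
    [MeasurableSpace E] [BorelSpace E] [FiniteDimensional ℝ E] [Nontrivial E]
    (μ : Measure E) [μ.IsAddHaarMeasure] :
    MeasurePreserving (fun p : sphere (0 : E) 1 × Ioi (0 : ℝ) => (p.2 : ℝ) • (p.1 : E))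
      (μ.toSphere.prod (Measure.volumeIoiPow (Module.finrank ℝ E - 1))) μ := by
  have h1 := μ.measurePreserving_homeomorphUnitSphereProd.symm
    (homeomorphUnitSphereProd E).toMeasurableEquiv
  have h2 : MeasurePreserving (Subtype.val : ({(0:E)}ᶜ : Set E) → E) (μ.comap (↑)) (μ.restrict {(0:E)}ᶜ) :=
    measurePreserving_subtype_coe (measurableSet_singleton _).compl
  rw [restrict_compl_singleton] at h2
  exact h2.comp h1

lemma aux_polar_lintegral {E : Type*} [NormedAddCommGroup E] [NormedSpace ℝ E]
    [MeasurableSpace E] [BorelSpace E] [FiniteDimensional ℝ E] [Nontrivial E]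
    (μ : Measure E) [μ.IsAddHaarMeasure] (f : E → ℝ≥0∞) (hf : Measurable f) :
    ∫⁻ ξ, f ξ ∂μ = ∫⁻ ω : sphere (0 : E) 1, (∫⁻ r in Ioi (0:ℝ),
      ENNReal.ofReal (r ^ (Module.finrank ℝ E - 1)) * f (r • (ω : E))) ∂μ.toSphere := by
  have hP := aux_polar_map μ
  rw [← hP.lintegral_comp hf, lintegral_prod (fun p : sphere (0 : E) 1 × Ioi (0 : ℝ) => f ((p.2 : ℝ) • (p.1 : E))) (hf.comp hP.measurable).aemeasurable]
  congr 1
  ext ω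
  have hm : Measurable fun r : Ioi (0:ℝ) => f ((r:ℝ) • (ω : E)) := by
    apply hf.comp; fun_prop
  simp only [Measure.volumeIoiPow]
  rw [lintegral_withDensity_eq_lintegral_mul _ (by fun_prop) hm]
  rw [← lintegral_subtype_comap measurableSet_Ioi]
  rfl

lemma aux_polar_bound {E : Type*} [NormedAddCommGroup E] [NormedSpace ℝ E]
    [MeasurableSpace E] [BorelSpace E] [FiniteDimensional ℝ E] [Nontrivial E]
    (μ : Measure E) [μ.IsAddHaarMeasure] (f : E → ℂ) (hf : Integrable f μ) (B : ℝ)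
    (hB : ∀ ω : E, ‖ω‖ = 1 → ‖∫ r in Ioi (0:ℝ), ((r ^ (Module.finrank ℝ E - 1) : ℝ) : ℂ) * f (r • ω)‖ ≤ B) :
    ‖∫ ξ, f ξ ∂μ‖ ≤ B * μ.toSphere.real univ := by
  have hP := aux_polar_map μ
  have hfc := hP.integrable_comp_of_integrable hf
  have h0 := integral_map hP.measurable.aemeasurable (f := f) (by rw [hP.map_eq]; exact hf.1)
  rw [hP.map_eq] at h0
  rw [h0, integral_prod (fun p : sphere (0 : E) 1 × Ioi (0 : ℝ) => f ((p.2 : ℝ) • (p.1 : E))) hfc]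
  apply norm_integral_le_of_norm_le_const
  filter_upwards with ω
  refine le_of_eq_of_le ?_ (hB ω (by simp))
  congr 1
  simp only [Measure.volumeIoiPow, ENNReal.ofReal]
  rw [integral_withDensity_eq_integral_smul (by fun_prop),
    ← integral_subtype_comap measurableSet_Ioi]
  congr 1
  ext r
  rw [NNReal.smul_def, Real.coe_toNNReal _ (pow_nonneg (le_of_lt r.2) _)]
  simp

lemma aux_block {E : Type*} [NormedAddCommGroup E] [InnerProductSpace ℝ E]
    [MeasurableSpace E] [BorelSpace E] [FiniteDimensional ℝ E] [Nontrivial E]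
    (R : ℝ) (φ : E → ℝ) (hφ_meas : Measurable φ)
    (hφ'_cont : ∀ ω : E, ‖ω‖ = 1 →
      ContinuousOn (deriv fun s : ℝ => φ (s • ω)) (Set.Ioi R))
    (hφ'_infty : ∀ M : ℝ, ∃ r₀ : ℝ, ∀ r : ℝ, r₀ ≤ r →
      ∀ ω : E, ‖ω‖ = 1 → M ≤ |deriv (fun s : ℝ => φ (s • ω)) r|)
    (s : ℝ) (hs : s < 0) (M ε δ K N0 : ℝ) (hM : 0 < M) (hε : 0 < ε) (hδ : 0 < δ) (hK : 0 ≤ K) :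
    ∃ A : E → ℝ, Measurable A ∧ (∀ ξ, 0 ≤ A ξ) ∧ Integrable A ∧ ∫ ξ, A ξ = M ∧
      (∃ N1, ∀ ξ, A ξ ≠ 0 → N0 < ‖ξ‖ ∧ ‖ξ‖ < N1) ∧
      (∫⁻ ξ : E, ENNReal.ofReal ((1 + ‖ξ‖ ^ 2) ^ (s / 2) * A ξ)) ≤ ENNReal.ofReal ε ∧
      ∀ (x : E) (τ R' : ℝ), ‖x‖ ≤ K → δ ≤ |τ| →
        ‖∫ ξ in ball (0 : E) R',
          Complex.exp (Complex.I * (((inner ℝ x ξ : ℝ) + τ * φ ξ : ℝ) : ℂ)) * ((A ξ : ℝ) : ℂ)‖ ≤ ε := by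
  set n := Module.finrank ℝ E - 1 with hn
  set σ : ℝ := (volume : Measure E).toSphere.real univ with hσd
  have hσ : 0 < σ := by
    rw [hσd, Measure.toSphere_real_apply_univ]
    have h1 : 0 < Module.finrank ℝ E := Module.finrank_pos
    have h2 : 0 < (volume : Measure E).real (ball 0 1) := by
      rw [measureReal_def]
      exact ENNReal.toReal_pos (measure_ball_pos _ _ one_pos).ne' measure_ball_lt_top.ne
    positivity
  set ℓ : ℝ := 4 * M / (δ * ε) with hℓd
  have hℓ : 0 < ℓ := by positivity
  set Λ : ℝ := 2 * M * K * ℓ / ε + 1 with hΛd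
  have hΛ : 0 < Λ := by positivity
  set κ : ℝ := M / (ℓ * σ) with hκd
  have hκ : 0 < κ := by positivity
  obtain ⟨r0, hr0⟩ := hφ'_infty Λ
  obtain ⟨N, hN0, hN1, hNR, hNr, hNs⟩ : ∃ N : ℝ, N0 < N ∧ 1 < N ∧ R < N ∧ r0 < N ∧ M * N ^ s < ε := by
    have h1 : Tendsto (fun N : ℝ => M * N ^ s) atTop (𝓝 (M * 0)) := by
      have := tendsto_rpow_neg_atTop (y := -s) (by linarith)
      simp only [neg_neg] at this
      exact this.const_mul M
    rw [mul_zero] at h1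
    have h2 := h1.eventually (gt_mem_nhds hε)
    exact ((eventually_gt_atTop N0).and ((eventually_gt_atTop 1).and ((eventually_gt_atTop R).and
      ((eventually_gt_atTop r0).and h2)))).exists
  have hNpos : 0 < N := by linarith
  set D : E → ℝ := fun ξ => limsup (fun k : ℕ =>
    ((1 / ((k : ℝ) + 1)))⁻¹ * (φ (ξ + (1 / ((k : ℝ) + 1)) • (‖ξ‖⁻¹ • ξ)) - φ ξ)) atTop with hD
  have hDm : Measurable D := by
    apply Measurable.limsup
    intro k
    refine measurable_const.mul (Measurable.sub (hφ_meas.comp ?_) hφ_meas)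
    fun_prop
  set S : Set E := {ξ | N ≤ ‖ξ‖ ∧ |φ ξ - φ (N • (‖ξ‖⁻¹ • ξ))| ≤ ℓ} with hS
  have hSm : MeasurableSet S := by
    apply MeasurableSet.inter
    · exact measurableSet_le measurable_const measurable_norm
    · have : Measurable fun ξ : E => φ (N • (‖ξ‖⁻¹ • ξ)) := hφ_meas.comp (by fun_prop)
      exact measurableSet_le ((hφ_meas.sub this).abs) measurable_const
  set A : E → ℝ := S.indicator (fun ξ => κ * |D ξ| / ‖ξ‖ ^ n) with hA
  have hAm : Measurable A := by
    apply Measurable.indicator _ hSm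
    fun_prop
  have hA0 : ∀ ξ, 0 ≤ A ξ := by
    intro ξ
    apply indicator_nonneg
    intro ξ _
    positivity
  -- per-direction facts
  have hder : ∀ ω : E, ‖ω‖ = 1 → ∀ r, N ≤ r →
      HasDerivAt (fun s : ℝ => φ (s • ω)) (deriv (fun s : ℝ => φ (s • ω)) r) r := by
    intro ω hω r hr
    apply DifferentiableAt.hasDerivAt
    by_contra hcon
    have := hr0 r (by linarith) ω hω
    rw [deriv_zero_of_not_differentiableAt hcon, abs_zero] at this
    linarith
  have hDr : ∀ ω : E, ‖ω‖ = 1 → ∀ r, N ≤ r → D (r • ω) = deriv (fun s : ℝ => φ (s • ω)) r := by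
    intro ω hω r hr
    have hrp : 0 < r := by linarith
    have h1 := (hasDerivAt_iff_tendsto_slope_zero.1 (hder ω hω r hr))
    have h2 : Tendsto (fun k : ℕ => 1 / ((k : ℝ) + 1)) atTop (𝓝[≠] 0) := by
      apply tendsto_nhdsWithin_iff.2 ⟨tendsto_one_div_add_atTop_nhds_zero_nat, ?_⟩
      filter_upwards with k
      have : (0:ℝ) < 1 / ((k : ℝ) + 1) := by positivity
      exact this.ne'
    have h3 := (h1.comp h2).limsup_eq
    rw [← h3]
    simp only [hD]
    congr 1
    ext k
    simp only [Function.comp, smul_eq_mul]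
    have : ‖r • ω‖⁻¹ • r • ω = ω := by
      rw [norm_smul, hω, Real.norm_of_nonneg hrp.le, mul_one, smul_smul, inv_mul_cancel₀ hrp.ne', one_smul]
    rw [this, add_smul]
  have hray : ∀ ω : E, ‖ω‖ = 1 → ∃ b, N ≤ b ∧ b ≤ N + ℓ / Λ ∧
      (∀ r, 0 < r → r ^ n * A (r • ω) = (Icc N b).indicator (fun r => κ * |deriv (fun s : ℝ => φ (s • ω)) r|) r) ∧
      (∫ r in N..b, |deriv (fun s : ℝ => φ (s • ω)) r|) = ℓ ∧
      ∀ c ∈ Icc N b, ∀ x τ : ℝ, τ ≠ 0 →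
        ‖∫ r in N..c, ((|deriv (fun s : ℝ => φ (s • ω)) r| : ℝ) : ℂ) * Complex.exp (Complex.I * ((x * r + τ * φ (r • ω) : ℝ) : ℂ))‖
          ≤ 2 / |τ| + |x| * (ℓ / Λ) * ℓ := by
    intro ω hω
    obtain ⟨b, h1, h2, h3, h4, h5⟩ := aux_oneD (fun s : ℝ => φ (s • ω)) (deriv (fun s : ℝ => φ (s • ω))) N Λ ℓ hΛ hℓ
      (hder ω hω) ((hφ'_cont ω hω).mono (fun r hr => hNR.trans_le hr))
      (fun r hr => hr0 r (by linarith) ω hω)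
    refine ⟨b, h1, h2, ?_, h4, h5⟩
    intro r hr
    have hnr : ‖r • ω‖ = r := by rw [norm_smul, hω, Real.norm_of_nonneg hr.le, mul_one]
    have hnr' : ‖r • ω‖⁻¹ • r • ω = ω := by
      rw [hnr, smul_smul, inv_mul_cancel₀ hr.ne', one_smul]
    have hmem : r • ω ∈ S ↔ r ∈ Icc N b := by
      change (N ≤ ‖r • ω‖ ∧ |φ (r • ω) - φ (N • (‖r • ω‖⁻¹ • r • ω))| ≤ ℓ) ↔ _
      rw [hnr', hnr, mem_Icc]
      constructor
      · rintro ⟨ha, hb⟩; exact ⟨ha, (h3 r ha).1 hb⟩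
      · rintro ⟨ha, hb⟩; exact ⟨ha, (h3 r ha).2 hb⟩
    by_cases hm : r ∈ Icc N b
    · rw [indicator_of_mem hm, hA, indicator_of_mem (hmem.2 hm), hDr ω hω r hm.1, hnr]
      field_simp
    · rw [indicator_of_notMem hm, hA, indicator_of_notMem (fun h => hm (hmem.1 h)), mul_zero]
  have hci : ∀ ω : E, ‖ω‖ = 1 → ∀ b, N ≤ b → IntegrableOn (fun r => κ * |deriv (fun s : ℝ => φ (s • ω)) r|) (Icc N b) := by
    intro ω hω b hb
    apply ContinuousOn.integrableOn_Icc
    apply continuousOn_const.mul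
    exact ((hφ'_cont ω hω).mono (fun r hr => hNR.trans_le hr.1)).abs
  have hlint : ∫⁻ ξ, ENNReal.ofReal (A ξ) = ENNReal.ofReal M := by
    rw [aux_polar_lintegral _ _ hAm.ennreal_ofReal]
    have : ∀ ω : sphere (0:E) 1, (∫⁻ r in Ioi (0:ℝ),
      ENNReal.ofReal (r ^ (Module.finrank ℝ E - 1)) * ENNReal.ofReal (A (r • (ω : E)))) = ENNReal.ofReal (κ * ℓ) := by
      intro ω
      have hω : ‖(ω : E)‖ = 1 := by simp
      obtain ⟨b, h1, h2, h3, h4, h5⟩ := hray ω hω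
      rw [setLIntegral_congr_fun (g := (Icc N b).indicator (fun r => ENNReal.ofReal (κ * |deriv (fun s : ℝ => φ (s • (ω:E))) r|))) measurableSet_Ioi]
      · rw [lintegral_indicator measurableSet_Icc, Measure.restrict_restrict measurableSet_Icc,
          inter_eq_left.2 (show Icc N b ⊆ Ioi 0 from fun r hr => hNpos.trans_le hr.1),
          ← ofReal_integral_eq_lintegral_ofReal (hci ω hω b h1) (ae_of_all _ fun r => by positivity),
          integral_Icc_eq_integral_Ioc, ← intervalIntegral.integral_of_le h1,
          intervalIntegral.integral_const_mul, h4]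
      · intro r hr
        have hr' : 0 < r := hr
        simp only
        rw [← ENNReal.ofReal_mul (by positivity), h3 r hr]
        by_cases hm : r ∈ Icc N b
        · simp [hm]
        · simp [hm]
    rw [lintegral_congr this, lintegral_const]
    have h1 : (volume : Measure E).toSphere univ = ENNReal.ofReal σ := by
      rw [hσd, ofReal_measureReal]
    rw [h1, ← ENNReal.ofReal_mul (by positivity)]
    congr 1
    rw [hκd]; field_simp
  have hAi : Integrable A := by
    refine ⟨hAm.aestronglyMeasurable, ?_⟩
    rw [hasFiniteIntegral_iff_ofReal (ae_of_all _ hA0), hlint]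
    exact ENNReal.ofReal_lt_top
  have hsupp : ∀ ξ, A ξ ≠ 0 → N ≤ ‖ξ‖ ∧ ‖ξ‖ < N + ℓ / Λ + 1 := by
    intro ξ hξ
    have hNξ : N ≤ ‖ξ‖ := (mem_of_indicator_ne_zero hξ).1
    refine ⟨hNξ, ?_⟩
    have hp : 0 < ‖ξ‖ := by linarith
    have hω : ‖‖ξ‖⁻¹ • ξ‖ = 1 := by rw [norm_smul, norm_inv, norm_norm, inv_mul_cancel₀ hp.ne']
    obtain ⟨b, h1, h2, h3, h4, h5⟩ := hray _ hω
    have h6 := h3 ‖ξ‖ hp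
    rw [smul_smul ‖ξ‖, mul_inv_cancel₀ hp.ne', one_smul] at h6
    have h7 : ‖ξ‖ ∈ Icc N b := by
      by_contra hcon
      rw [indicator_of_notMem hcon] at h6
      have : ‖ξ‖ ^ n ≠ 0 := by positivity
      exact (mul_ne_zero this hξ) h6
    linarith [h7.2]
  refine ⟨A, hAm, hA0, hAi, ?_, ⟨N + ℓ / Λ + 1, fun ξ hξ => ⟨hN0.trans_le (hsupp ξ hξ).1, (hsupp ξ hξ).2⟩⟩, ?_, ?_⟩
  · rw [integral_eq_lintegral_of_nonneg_ae (ae_of_all _ hA0) hAm.aestronglyMeasurable, hlint,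
      ENNReal.toReal_ofReal hM.le]
  · calc _ ≤ ∫⁻ ξ : E, ENNReal.ofReal (N ^ s) * ENNReal.ofReal (A ξ) := by
          apply lintegral_mono
          intro ξ
          simp only
          rw [← ENNReal.ofReal_mul (by positivity)]
          apply ENNReal.ofReal_le_ofReal
          by_cases hξ : A ξ = 0
          · simp [hξ]
          · apply mul_le_mul_of_nonneg_right _ (hA0 ξ)
            have h1 := (hsupp ξ hξ).1
            have h2 : N ^ s = (N ^ 2) ^ (s / 2) := by
              rw [← Real.rpow_natCast, ← Real.rpow_mul hNpos.le]
              congr 1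
              push_cast; ring
            rw [h2]
            apply Real.rpow_le_rpow_of_nonpos (by positivity) _ (by linarith)
            nlinarith
      _ = ENNReal.ofReal (N ^ s) * ENNReal.ofReal M := by
          rw [lintegral_const_mul _ hAm.ennreal_ofReal, hlint]
      _ ≤ ENNReal.ofReal ε := by
          rw [← ENNReal.ofReal_mul (by positivity), mul_comm]
          exact ENNReal.ofReal_le_ofReal hNs.le
  · intro x τ R' hx hτ
    have hτ0 : τ ≠ 0 := by
      intro h; rw [h, abs_zero] at hτ; linarith
    rw [← integral_indicator measurableSet_ball]
    have hfi : Integrable (fun ξ => Complex.exp (Complex.I * (((inner ℝ x ξ : ℝ) + τ * φ ξ : ℝ) : ℂ)) * ((A ξ : ℝ) : ℂ)) := by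
      apply hAi.ofReal.bdd_mul (c := 1)
      · apply Measurable.aestronglyMeasurable
        fun_prop
      · filter_upwards with ξ
        rw [mul_comm Complex.I, Complex.norm_exp_ofReal_mul_I]
    have hbd := aux_polar_bound (volume : Measure E) _ (hfi.indicator (measurableSet_ball (x := (0:E)) (ε := R'))) (κ * (2 / δ + K * (ℓ / Λ) * ℓ)) ?_
    · refine hbd.trans ?_
      rw [← hσd]
      have e1 : κ * (2 / δ + K * (ℓ / Λ) * ℓ) * σ = M * (2 / (δ * ℓ)) + M * K * ℓ / Λ := by
        rw [hκd]; field_simp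
      have e2 : M * (2 / (δ * ℓ)) = ε / 2 := by
        rw [hℓd]; field_simp; ring
      have e3 : M * K * ℓ / Λ ≤ ε / 2 := by
        rw [div_le_iff₀ hΛ, hΛd]
        have : ε / 2 * (2 * M * K * ℓ / ε + 1) = M * K * ℓ + ε / 2 := by field_simp
        linarith
      linarith
    · intro ω hω
      obtain ⟨b, h1, h2, h3, h4, h5⟩ := hray ω hω
      have hxω : |inner ℝ x ω| ≤ K := by
        refine (abs_real_inner_le_norm x ω).trans ?_
        rw [hω, mul_one]; exact hx
      set F : ℝ → ℂ := fun r => ((|deriv (fun s : ℝ => φ (s • ω)) r| : ℝ) : ℂ) * Complex.exp (Complex.I * ((inner ℝ x ω * r + τ * φ (r • ω) : ℝ) : ℂ)) with hF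
      have hset : ∀ c ∈ Icc N b, ‖∫ r in N..c, F r‖ ≤ 2 / δ + K * (ℓ / Λ) * ℓ := by
        intro c hc
        refine (h5 c hc _ τ hτ0).trans ?_
        gcongr
      have hB0 : 0 ≤ 2 / δ + K * (ℓ / Λ) * ℓ := by positivity
      have hcongr : (∫ r in Ioi (0:ℝ), ((r ^ (Module.finrank ℝ E - 1) : ℝ) : ℂ) * (ball (0:E) R').indicator (fun ξ => Complex.exp (Complex.I * (((inner ℝ x ξ : ℝ) + τ * φ ξ : ℝ) : ℂ)) * ((A ξ : ℝ) : ℂ)) (r • ω))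
          = ∫ r in Ioi (0:ℝ), (Icc N b ∩ Iio R').indicator (fun r => (κ : ℂ) * F r) r := by
        apply setIntegral_congr_fun measurableSet_Ioi
        intro r hr
        have hr' : 0 < r := hr
        have hnr : ‖r • ω‖ = r := by rw [norm_smul, hω, Real.norm_of_nonneg hr'.le, mul_one]
        simp only
        by_cases hrR : r < R'
        · rw [indicator_of_mem (by simpa [hnr] using hrR)]
          have h6 := h3 r hr'
          rw [← hn]
          calc _ = ((r ^ n * A (r • ω) : ℝ) : ℂ) * Complex.exp (Complex.I * ((inner ℝ x (r • ω) + τ * φ (r • ω) : ℝ) : ℂ)) := by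
                push_cast; ring
            _ = _ := by
                rw [h6]
                by_cases hm : r ∈ Icc N b
                · rw [indicator_of_mem hm, indicator_of_mem (show r ∈ Icc N b ∩ Iio R' from ⟨hm, hrR⟩), hF, inner_smul_right]
                  push_cast
                  rw [mul_comm (r : ℂ)]
                  ring
                · rw [indicator_of_notMem hm, indicator_of_notMem (fun h => hm h.1)]
                  simp
        · rw [indicator_of_notMem (by simpa [hnr] using hrR), indicator_of_notMem (fun h => hrR h.2), mul_zero]
      rw [hcongr, integral_indicator (measurableSet_Icc.inter measurableSet_Iio),
        Measure.restrict_restrict (measurableSet_Icc.inter measurableSet_Iio),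
        inter_eq_left.2 (show Icc N b ∩ Iio R' ⊆ Ioi 0 from fun r hr => hNpos.trans_le hr.1.1), integral_const_mul, norm_mul,
        Complex.norm_real, Real.norm_of_nonneg hκ.le]
      apply mul_le_mul_of_nonneg_left _ hκ.le
      rcases le_or_gt R' N with hRN | hRN
      · have : Icc N b ∩ Iio R' = ∅ := by
          ext r; simp; intro h _; linarith
        rw [this]; simpa using hB0
      rcases lt_or_ge b R' with hbR | hbR
      · have : Icc N b ∩ Iio R' = Icc N b := inter_eq_left.2 (fun r hr => lt_of_le_of_lt hr.2 hbR)
        rw [this, integral_Icc_eq_integral_Ioc, ← intervalIntegral.integral_of_le h1]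
        exact hset b ⟨h1, le_rfl⟩
      · have : Icc N b ∩ Iio R' = Ico N R' := by
          ext r; simp only [mem_inter_iff, mem_Icc, mem_Iio, mem_Ico]
          constructor
          · rintro ⟨⟨a1, a2⟩, a3⟩; exact ⟨a1, a3⟩
          · rintro ⟨a1, a2⟩; exact ⟨⟨a1, by linarith⟩, a2⟩
        rw [this, integral_Ico_eq_integral_Ioo, ← integral_Ioc_eq_integral_Ioo, ← intervalIntegral.integral_of_le hRN.le]
        exact hset R' ⟨hRN.le, hbR⟩

lemma aux_list_rec {α : Type*} (P : List α → α → Prop) (h : ∀ l, ∃ a, P l a) :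
    ∃ f : ℕ → α, ∀ k, P ((List.range k).map f) (f k) := by
  choose c hc using h
  let L : ℕ → List α := fun k => Nat.rec [] (fun _ l => l ++ [c l]) k
  have hL : ∀ k, L k = (List.range k).map (fun j => c (L j)) := by
    intro k
    induction k with
    | zero => rfl
    | succ k ih =>
      rw [List.range_succ, List.map_append, ← ih]
      rfl
  refine ⟨fun j => c (L j), fun k => ?_⟩
  rw [← hL k]
  exact hc _

lemma aux_points {E : Type*} [NormedAddCommGroup E] [NormedSpace ℝ E] [FiniteDimensional ℝ E]
    (γ : ℝ → ℝ) (hγ_mono : StrictMonoOn γ (Set.Ici 0)) (hγ_zero : γ 0 = 0) :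
    ∃ (y : ℕ → E) (t : ℕ → ℝ), (∀ k, 0 < t k) ∧ (∀ j k, j < k → t j ≠ t k) ∧
      Tendsto t atTop (𝓝 0) ∧ ∀ x, ∃ᶠ k in atTop, ‖y k - x‖ < γ (t k) := by
  have : ProperSpace E := FiniteDimensional.proper ℝ E
  have hγpos : ∀ t, 0 < t → 0 < γ t := fun t ht => by
    rw [← hγ_zero]; exact hγ_mono (mem_Ici.2 le_rfl) (mem_Ici.2 ht.le) ht
  have hq : ∀ m : ℕ, (0:ℝ) < 1 / ((m:ℝ) + 2) := fun m => by positivity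
  have hcov : ∀ m : ℕ, ∃ F : Set E, F.Nonempty ∧ F.Finite ∧
      ∀ x : E, ‖x‖ ≤ m → ∃ p ∈ F, ‖p - x‖ < γ (1 / ((m:ℝ) + 2)) := by
    intro m
    obtain ⟨F, hF1, hF2, hF3⟩ := (isCompact_closedBall (0:E) (m:ℝ)).finite_cover_balls (hγpos _ (hq m))
    have hx : ∀ x : E, ‖x‖ ≤ m → ∃ p ∈ F, ‖p - x‖ < γ (1 / ((m:ℝ) + 2)) := by
      intro x hx
      have := hF3 (show x ∈ closedBall (0:E) m by simpa using hx)
      simp only [mem_iUnion, mem_ball] at this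
      obtain ⟨p, hp, hp'⟩ := this
      exact ⟨p, hp, by rwa [dist_comm, dist_eq_norm] at hp'⟩
    obtain ⟨p, hp, _⟩ := hx 0 (by simp)
    exact ⟨F, ⟨p, hp⟩, hF2, hx⟩
  choose F hF1 hF2 hF3 using hcov
  have hFfin : ∀ m, Finite (F m) := fun m => (hF2 m).to_subtype
  have hFne : ∀ m, Nonempty (F m) := fun m => (hF1 m).to_subtype
  have hinf : Infinite (Σ m : ℕ, F m) := by
    apply Infinite.of_surjective (Sigma.fst : (Σ m : ℕ, F m) → ℕ)
    intro m
    exact ⟨⟨m, Classical.arbitrary _⟩, rfl⟩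
  obtain ⟨e⟩ := nonempty_equiv_of_countable (α := ℕ) (β := Σ m : ℕ, F m)
  have hmt : Tendsto (fun k => (e k).1) atTop atTop := by
    rw [Filter.tendsto_atTop]
    intro b
    rw [← Nat.cofinite_eq_atTop, eventually_cofinite]
    have : {i : Σ m : ℕ, F m | ¬ b ≤ i.1}.Finite := by
      have h1 : (⋃ m ∈ Iio b, range (fun p : F m => (⟨m, p⟩ : Σ m : ℕ, F m))).Finite :=
        (finite_Iio b).biUnion (fun m _ => finite_range _)
      refine h1.subset ?_
      rintro ⟨m, p⟩ hm
      simp only [mem_iUnion]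
      exact ⟨m, not_le.1 hm, p, rfl⟩
    exact this.preimage e.injective.injOn
  obtain ⟨t, ht⟩ := aux_list_rec (α := ℝ) (fun l a => a ∈ Ioo (1 / (((e l.length).1:ℝ) + 2))
      (1 / (((e l.length).1:ℝ) + 2) + 1 / ((l.length : ℝ) + 1)) ∧ a ∉ l) (by
    intro l
    have h1 : (Ioo (1 / (((e l.length).1:ℝ) + 2))
      (1 / (((e l.length).1:ℝ) + 2) + 1 / ((l.length : ℝ) + 1))).Infinite := by
      apply Ioo_infinite
      have : (0:ℝ) < 1 / ((l.length : ℝ) + 1) := by positivity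
      linarith
    obtain ⟨a, ha, ha'⟩ := h1.exists_notMem_finite (List.finite_toSet l)
    exact ⟨a, ha, ha'⟩)
  simp only [List.length_map, List.length_range] at ht
  refine ⟨fun k => (e k).2, t, fun k => (hq _).trans (ht k).1.1, ?_, ?_, ?_⟩
  · intro j k hjk h
    apply (ht k).2
    rw [List.mem_map]
    exact ⟨j, List.mem_range.2 hjk, h⟩
  · have h1 : Tendsto (fun m : ℕ => 1 / ((m:ℝ) + 2)) atTop (𝓝 0) := by
      apply Tendsto.div_atTop tendsto_const_nhds
      exact tendsto_atTop_add_const_right _ _ tendsto_natCast_atTop_atTop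
    have h2 := (h1.comp hmt).add tendsto_one_div_add_atTop_nhds_zero_nat
    rw [add_zero] at h2
    exact squeeze_zero (fun k => ((hq _).trans (ht k).1.1).le) (fun k => (ht k).1.2.le) h2
  · intro x
    rw [frequently_atTop]
    intro a
    obtain ⟨m, hm1, hm2⟩ : ∃ m : ℕ, ‖x‖ ≤ m ∧ ∀ k, (e k).1 = m → a ≤ k := by
      obtain ⟨m1, hm1⟩ := exists_nat_ge ‖x‖
      let m2 := (Finset.range a).sup (fun k => (e k).1)
      refine ⟨max m1 (m2 + 1), ?_, ?_⟩
      · refine hm1.trans ?_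
        exact_mod_cast le_max_left _ _
      · intro k hk
        by_contra hcon
        have : (e k).1 ≤ m2 := Finset.le_sup (f := fun k => (e k).1) (Finset.mem_range.2 (not_le.1 hcon))
        have := le_max_right m1 (m2 + 1)
        omega
    obtain ⟨p, hp, hpx⟩ := hF3 m x hm1
    refine ⟨e.symm ⟨m, p, hp⟩, hm2 _ (by simp), ?_⟩
    have h3 := (ht (e.symm ⟨m, p, hp⟩)).1.1
    have hy : ((e (e.symm ⟨m, p, hp⟩)).2 : E) = p := by rw [Equiv.apply_symm_apply]
    simp only [Equiv.apply_symm_apply] at h3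
    beta_reduce
    rw [hy]
    exact hpx.trans (hγ_mono (mem_Ici.2 (hq m).le) (mem_Ici.2 ((hq m).trans h3).le) h3)

/-- Main theorem, case `p = 1`, `s < 0`: there is initial datum in
`𝓕L^1_s(ℝ^d)` whose generalized Schrödinger evolution diverges non-tangentially
at every point. -/
theorem nontangential_divergence_FL1
    (d : ℕ) (hd : 1 ≤ d)
    (γ : ℝ → ℝ) (hγ_mono : StrictMonoOn γ (Set.Ici 0))
    (hγ_cont : ContinuousOn γ (Set.Ici 0)) (hγ_zero : γ 0 = 0)
    (hγ_nonneg : ∀ t : ℝ, 0 ≤ t → 0 ≤ γ t)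
    (R : ℝ) (hR : 0 < R)
    (φ : EuclideanSpace ℝ (Fin d) → ℝ) (hφ_meas : Measurable φ)
    (hφ'_cont : ∀ ω : EuclideanSpace ℝ (Fin d), ‖ω‖ = 1 →
      ContinuousOn (deriv fun s : ℝ => φ (s • ω)) (Set.Ioi R))
    (hφ''_cont : ∀ ω : EuclideanSpace ℝ (Fin d), ‖ω‖ = 1 →
      ContinuousOn (deriv (deriv fun s : ℝ => φ (s • ω))) (Set.Ioi R))
    (hφ'_infty : ∀ M : ℝ, ∃ r₀ : ℝ, ∀ r : ℝ, r₀ ≤ r →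
      ∀ ω : EuclideanSpace ℝ (Fin d), ‖ω‖ = 1 →
        M ≤ |deriv (fun s : ℝ => φ (s • ω)) r|)
    (hφ'' : ∃ β : ℝ, 0 < β ∧ ∃ C : ℝ, 0 < C ∧ ∀ r : ℝ, R ≤ r →
      ∀ ω : EuclideanSpace ℝ (Fin d), ‖ω‖ = 1 →
        r ^ β * |deriv (deriv fun s : ℝ => φ (s • ω)) r| /
          (deriv (fun s : ℝ => φ (s • ω)) r) ^ 2 < C)
    (s : ℝ) (hs : s < 0) :
    ∃ (g : EuclideanSpace ℝ (Fin d) → ℂ) (u : EuclideanSpace ℝ (Fin d) → ℝ → ℂ),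
      Measurable g ∧
      (∫⁻ ξ : EuclideanSpace ℝ (Fin d),
          ENNReal.ofReal ((1 + ‖ξ‖ ^ 2) ^ (s / 2) * ‖g ξ‖)) < ⊤ ∧
      ContinuousOn (fun q : EuclideanSpace ℝ (Fin d) × ℝ => u q.1 q.2)
        {q : EuclideanSpace ℝ (Fin d) × ℝ | 0 < q.2} ∧
      (∀ (x : EuclideanSpace ℝ (Fin d)) (t : ℝ), 0 < t →
        Tendsto (fun R' : ℝ =>
            (((2 * Real.pi) ^ d : ℝ) : ℂ)⁻¹ *
              ∫ ξ in Metric.ball (0 : EuclideanSpace ℝ (Fin d)) R',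
                Complex.exp (Complex.I * (((inner ℝ x ξ : ℝ) + t * φ ξ : ℝ) : ℂ)) * g ξ)
          atTop (𝓝 (u x t))) ∧
      (∀ x : EuclideanSpace ℝ (Fin d),
        Filter.limsup
            (fun q : EuclideanSpace ℝ (Fin d) × ℝ => ((‖u q.1 q.2‖ : ℝ) : EReal))
            ((𝓝 (x, (0 : ℝ))) ⊓
              Filter.principal
                {q : EuclideanSpace ℝ (Fin d) × ℝ | ‖q.1 - x‖ < γ q.2 ∧ 0 < q.2}) = ⊤) := by
  have : Nonempty (Fin d) := ⟨⟨0, hd⟩⟩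
  have hnt : Nontrivial (EuclideanSpace ℝ (Fin d)) := inferInstance
  obtain ⟨y, t, ht0, htinj, htlim, hhit⟩ := aux_points (E := EuclideanSpace ℝ (Fin d)) γ hγ_mono hγ_zero
  have hδex : ∀ k : ℕ, ∃ δ : ℝ, 0 < δ ∧ δ ≤ 1 / ((k:ℝ) + 1) ∧ ∀ j < k, δ ≤ |t j - t k| := by
    intro k
    have h1 : ∀ᶠ δ in 𝓝[>] (0:ℝ), δ < 1 / ((k:ℝ) + 1) :=
      nhdsWithin_le_nhds (gt_mem_nhds (by positivity))
    have h2 : ∀ᶠ δ in 𝓝[>] (0:ℝ), ∀ j ∈ Finset.range k, δ < |t j - t k| := by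
      rw [Filter.eventually_all_finset]
      intro j hj
      exact nhdsWithin_le_nhds (gt_mem_nhds (abs_pos.2 (sub_ne_zero.2 (htinj j k (Finset.mem_range.1 hj)))))
    have h3 : ∀ᶠ δ in 𝓝[>] (0:ℝ), 0 < δ := eventually_mem_nhdsWithin
    obtain ⟨δ, a1, a2, a3⟩ := (h1.and (h2.and h3)).exists
    exact ⟨δ, a3, a1.le, fun j hj => (a2 j (Finset.mem_range.2 hj)).le⟩
  choose δ hδ0 hδ1 hδ2 using hδex
  set K : ℕ → ℝ := fun k => k + ∑ j ∈ Finset.range (k + 1), ‖y j‖ with hKd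
  have hK0 : ∀ k, 0 ≤ K k := fun k => by positivity
  choose A hAm hA0 hAi hAint hAsupp hAw hAb using fun k : ℕ =>
    aux_block R φ hφ_meas hφ'_cont hφ'_infty s hs (4 ^ k) ((1/2) ^ k) (δ k) (K k) k
      (by positivity) (by positivity) (hδ0 k) (hK0 k)
  choose N1 hN1 using hAsupp
  -- the pieces
  set G : ℕ → EuclideanSpace ℝ (Fin d) → ℂ := fun k ξ =>
    Complex.exp (Complex.I * ((-(inner ℝ (y k) ξ + t k * φ ξ) : ℝ) : ℂ)) * ((A k ξ : ℝ) : ℂ) with hG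
  have hGm : ∀ k, Measurable (G k) := by
    intro k
    have := hAm k
    simp only [hG]
    fun_prop
  have hGn : ∀ k ξ, ‖G k ξ‖ = A k ξ := by
    intro k ξ
    simp only [hG]
    rw [norm_mul, mul_comm Complex.I, Complex.norm_exp_ofReal_mul_I, one_mul, Complex.norm_real,
      Real.norm_of_nonneg (hA0 k ξ)]
  have hG0 : ∀ (k : ℕ) ξ, ‖ξ‖ ≤ k → G k ξ = 0 := by
    intro k ξ h
    rw [← norm_eq_zero, hGn]
    by_contra hcon
    linarith [(hN1 k ξ hcon).1]
  have hGi : ∀ k, Integrable (G k) := fun k =>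
    (hAi k).mono' (hGm k).aestronglyMeasurable (ae_of_all _ fun ξ => (hGn k ξ).le)
  set H : ℕ → EuclideanSpace ℝ (Fin d) → ℝ → EuclideanSpace ℝ (Fin d) → ℂ := fun k x τ ξ =>
    Complex.exp (Complex.I * (((inner ℝ x ξ : ℝ) + τ * φ ξ : ℝ) : ℂ)) * G k ξ with hH
  have hHn : ∀ k x τ ξ, ‖H k x τ ξ‖ = A k ξ := by
    intro k x τ ξ
    simp only [hH]
    rw [norm_mul, mul_comm Complex.I, Complex.norm_exp_ofReal_mul_I, one_mul, hGn]
  have hHm : ∀ k x τ, Measurable (H k x τ) := by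
    intro k x τ
    have := hGm k
    simp only [hH]
    fun_prop
  have hHi : ∀ k x τ, Integrable (H k x τ) := fun k x τ =>
    (hAi k).mono' (hHm k x τ).aestronglyMeasurable (ae_of_all _ fun ξ => (hHn k x τ ξ).le)
  have hHA : ∀ k x τ ξ, H k x τ ξ = Complex.exp (Complex.I * (((inner ℝ (x - y k) ξ : ℝ) + (τ - t k) * φ ξ : ℝ) : ℂ)) * ((A k ξ : ℝ) : ℂ) := by
    intro k x τ ξ
    simp only [hH, hG]
    rw [← mul_assoc, ← Complex.exp_add, inner_sub_left]
    congr 2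
    push_cast; ring
  set T : ℕ → EuclideanSpace ℝ (Fin d) → ℝ → ℝ → ℂ := fun k x τ R' => ∫ ξ in ball (0:EuclideanSpace ℝ (Fin d)) R', H k x τ ξ with hT
  set U : ℕ → EuclideanSpace ℝ (Fin d) → ℝ → ℂ := fun k x τ => ∫ ξ, H k x τ ξ with hU
  have hTU : ∀ k x τ R', N1 k ≤ R' → T k x τ R' = U k x τ := by
    intro k x τ R' hR'
    apply setIntegral_eq_integral_of_forall_compl_eq_zero
    intro ξ hξ
    rw [← norm_eq_zero, hHn]
    by_contra hcon
    apply hξ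
    have := (hN1 k ξ hcon).2
    simp only [mem_ball, dist_zero_right]
    linarith
  have hTb : ∀ k x τ R', ‖T k x τ R'‖ ≤ 4 ^ k := by
    intro k x τ R'
    refine (norm_integral_le_integral_norm _).trans ?_
    simp only [hHn]
    rw [← hAint k]
    exact setIntegral_le_integral (hAi k) (ae_of_all _ (hA0 k))
  have hTs : ∀ k x τ R', ‖x - y k‖ ≤ K k → δ k ≤ |τ - t k| → ‖T k x τ R'‖ ≤ (1/2) ^ k := by
    intro k x τ R' h1 h2
    have := hAb k (x - y k) (τ - t k) R' h1 h2
    simp only [hT, hHA]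
    exact this
  have hUb : ∀ k x τ, ‖U k x τ‖ ≤ 4 ^ k := fun k x τ => by
    rw [← hTU k x τ (N1 k) le_rfl]; exact hTb _ _ _ _
  have hUs : ∀ k x τ, ‖x - y k‖ ≤ K k → δ k ≤ |τ - t k| → ‖U k x τ‖ ≤ (1/2) ^ k := fun k x τ => by
    rw [← hTU k x τ (N1 k) le_rfl]; exact hTs _ _ _ _
  have hUk : ∀ k, U k (y k) (t k) = 4 ^ k := by
    intro k
    simp only [hU, hHA]
    simp only [sub_self, inner_zero_left, zero_mul, add_zero, Complex.ofReal_zero, mul_zero, Complex.exp_zero, one_mul]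
    have := integral_ofReal (μ := (volume : Measure (EuclideanSpace ℝ (Fin d)))) (𝕜 := ℂ) (f := A k)
    rw [hAint k] at this
    refine Eq.trans this ?_
    norm_num
  have hUc : ∀ k, Continuous fun q : EuclideanSpace ℝ (Fin d) × ℝ => U k q.1 q.2 := by
    intro k
    simp only [hU]
    refine continuous_of_dominated (bound := A k) (fun q => (hHm k q.1 q.2).aestronglyMeasurable)
      (fun q => ae_of_all _ fun ξ => (hHn _ _ _ _).le) (hAi k) (ae_of_all _ fun ξ => ?_)
    simp only [hH]
    fun_prop
  have hunif : ∀ X τ₀ : ℝ, 0 < τ₀ → ∃ k0 : ℕ, ∀ k ≥ k0, ∀ (x : EuclideanSpace ℝ (Fin d)) (τ : ℝ), ‖x‖ ≤ X → τ₀ ≤ τ →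
      ‖x - y k‖ ≤ K k ∧ δ k ≤ |τ - t k| := by
    intro X τ₀ hτ₀
    have h1 : Tendsto (fun k : ℕ => t k + 1 / ((k:ℝ) + 1)) atTop (𝓝 (0 + 0)) :=
      htlim.add tendsto_one_div_add_atTop_nhds_zero_nat
    rw [add_zero] at h1
    have h2 := h1.eventually (gt_mem_nhds hτ₀)
    have h3 := tendsto_natCast_atTop_atTop (R := ℝ).eventually (eventually_ge_atTop X)
    obtain ⟨k0, hk0⟩ := eventually_atTop.1 (h2.and h3)
    refine ⟨k0, fun k hk x τ hx hτ => ⟨?_, ?_⟩⟩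
    · have h4 : ‖y k‖ ≤ ∑ j ∈ Finset.range (k + 1), ‖y j‖ :=
        Finset.single_le_sum (f := fun j => ‖y j‖) (fun j _ => norm_nonneg _) (Finset.mem_range.2 (Nat.lt_succ_self k))
      have h5 := (hk0 k hk).2
      have h6 := norm_sub_le x (y k)
      simp only [hKd]
      linarith
    · refine le_trans ?_ (le_abs_self _)
      have := (hk0 k hk).1
      have := hδ1 k
      linarith
  -- summable majorant
  have hbs : ∀ k0 : ℕ, Summable (fun k : ℕ => if k < k0 then (4:ℝ) ^ k else (1/2) ^ k) := by
    intro k0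
    rw [← summable_nat_add_iff k0]
    have : Summable (fun k : ℕ => ((1:ℝ)/2) ^ (k + k0)) :=
      (summable_nat_add_iff k0).2 summable_geometric_two
    refine this.congr (fun k => ?_)
    simp
  have hUsum : ∀ x τ, 0 < τ → Summable (fun k => U k x τ) := by
    intro x τ hτ
    obtain ⟨k0, hk0⟩ := hunif ‖x‖ τ hτ
    apply Summable.of_norm_bounded (hbs k0)
    intro k
    split_ifs with h
    · exact hUb _ _ _
    · obtain ⟨h1, h2⟩ := hk0 k (not_lt.1 h) x τ le_rfl le_rfl
      exact hUs _ _ _ h1 h2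
  set C : ℂ := (((2 * Real.pi) ^ d : ℝ) : ℂ)⁻¹ with hC
  have hCpos : 0 < ‖C‖ := by
    rw [hC, norm_pos_iff]
    apply inv_ne_zero
    have : (0:ℝ) < (2 * Real.pi) ^ d := by positivity
    exact_mod_cast this.ne'
  have hgfin : ∀ (n : ℕ) (ξ : EuclideanSpace ℝ (Fin d)), ‖ξ‖ ≤ n → ∑' k, G k ξ = ∑ k ∈ Finset.range n, G k ξ := by
    intro n ξ h
    apply tsum_eq_sum
    intro k hk
    apply hG0
    have : n ≤ k := by simpa using hk
    exact h.trans (by exact_mod_cast this)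
  refine ⟨fun ξ => ∑' k, G k ξ, fun x τ => C * ∑' k, U k x τ, ?_, ?_, ?_, ?_, ?_⟩
  · apply measurable_of_tendsto_metrizable (f := fun (n : ℕ) ξ => ∑ k ∈ Finset.range n, G k ξ)
    · intro n
      exact Finset.measurable_fun_sum _ (fun k _ => hGm k)
    · rw [tendsto_pi_nhds]
      intro ξ
      obtain ⟨n0, hn0⟩ := exists_nat_ge ‖ξ‖
      apply tendsto_const_nhds.congr'
      filter_upwards [eventually_ge_atTop n0] with n hn
      exact hgfin n ξ (hn0.trans (by exact_mod_cast hn))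
  · calc _ ≤ ∫⁻ ξ : EuclideanSpace ℝ (Fin d), ∑' k, ENNReal.ofReal ((1 + ‖ξ‖ ^ 2) ^ (s / 2) * A k ξ) := by
          apply lintegral_mono
          intro ξ
          simp only
          obtain ⟨n, hn⟩ := exists_nat_ge ‖ξ‖
          rw [hgfin n ξ hn]
          refine le_trans ?_ (ENNReal.sum_le_tsum (Finset.range n))
          rw [← ENNReal.ofReal_sum_of_nonneg (fun k _ => mul_nonneg (by positivity) (hA0 k ξ)), ← Finset.mul_sum]
          apply ENNReal.ofReal_le_ofReal
          apply mul_le_mul_of_nonneg_left _ (by positivity)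
          refine (norm_sum_le _ _).trans ?_
          simp only [hGn]
          exact le_rfl
      _ = ∑' k, ∫⁻ ξ : EuclideanSpace ℝ (Fin d), ENNReal.ofReal ((1 + ‖ξ‖ ^ 2) ^ (s / 2) * A k ξ) := by
          apply lintegral_tsum
          intro k
          have := hAm k
          apply Measurable.aemeasurable
          apply Measurable.ennreal_ofReal
          fun_prop
      _ ≤ ∑' k : ℕ, ENNReal.ofReal ((1/2) ^ k) := ENNReal.tsum_le_tsum hAw
      _ < ⊤ := by
          rw [← ENNReal.ofReal_tsum_of_nonneg (fun k => by positivity) summable_geometric_two]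
          exact ENNReal.ofReal_lt_top
  · rintro ⟨x, τ⟩ (hτ : 0 < τ)
    apply ContinuousAt.continuousWithinAt
    obtain ⟨k0, hk0⟩ := hunif (‖x‖ + 1) (τ / 2) (by linarith)
    have hopen : {q : EuclideanSpace ℝ (Fin d) × ℝ | ‖q.1‖ < ‖x‖ + 1 ∧ τ / 2 < q.2} ∈ 𝓝 (x, τ) := by
      apply IsOpen.mem_nhds
      · exact (isOpen_lt (continuous_fst.norm) continuous_const).inter (isOpen_lt continuous_const continuous_snd)
      · constructor
        · show ‖x‖ < ‖x‖ + 1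
          linarith
        · show τ / 2 < τ
          linarith
    apply ContinuousAt.mul continuousAt_const
    refine ContinuousOn.continuousAt ?_ hopen
    refine continuousOn_tsum (fun k => (hUc k).continuousOn) (hbs k0) ?_
    rintro k ⟨x', τ'⟩ ⟨h1, h2⟩
    simp only at h1 h2 ⊢
    split_ifs with h
    · exact hUb _ _ _
    · obtain ⟨h1, h2⟩ := hk0 k (not_lt.1 h) x' τ' h1.le h2.le
      exact hUs _ _ _ h1 h2
  · intro x τ hτ
    apply Tendsto.const_mul
    obtain ⟨k0, hk0⟩ := hunif ‖x‖ τ hτ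
    have hlim : Tendsto (fun R' => ∑' k, T k x τ R') atTop (𝓝 (∑' k, U k x τ)) := by
      apply tendsto_tsum_of_dominated_convergence (hbs k0)
      · intro k
        apply tendsto_const_nhds.congr'
        filter_upwards [eventually_ge_atTop (N1 k)] with R' hR'
        exact (hTU k x τ R' hR').symm
      · filter_upwards with R'
        intro k
        split_ifs with h
        · exact hTb _ _ _ _
        · obtain ⟨h1, h2⟩ := hk0 k (not_lt.1 h) x τ le_rfl le_rfl
          exact hTs _ _ _ _ h1 h2
    refine hlim.congr (fun R' => ?_)
    obtain ⟨n, hn⟩ := exists_nat_ge R'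
    have h1 : ∑' k, T k x τ R' = ∑ k ∈ Finset.range n, T k x τ R' := by
      apply tsum_eq_sum
      intro k hk
      apply setIntegral_eq_zero_of_forall_eq_zero
      intro ξ hξ
      simp only [hH]
      rw [hG0, mul_zero]
      have h2 : n ≤ k := by simpa using hk
      have h3 : (n:ℝ) ≤ k := by exact_mod_cast h2
      simp only [mem_ball, dist_zero_right] at hξ
      linarith
    rw [h1]
    simp only [hT]
    rw [← integral_finsetSum _ (fun k _ => (hHi k x τ).integrableOn)]
    apply setIntegral_congr_fun measurableSet_ball
    intro ξ hξ
    simp only [mem_ball, dist_zero_right] at hξ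
    simp only [hH]
    rw [hgfin n ξ (by linarith), Finset.mul_sum]
  · intro x
    -- lower bound
    have hlow : ∀ k : ℕ, ‖C‖ * (2 / 3 * 4 ^ k - 2) ≤ ‖C * ∑' j, U j (y k) (t k)‖ := by
      intro k
      rw [norm_mul]
      apply mul_le_mul_of_nonneg_left _ (norm_nonneg _)
      have hsum := hUsum (y k) (t k) (ht0 k)
      rw [← hsum.sum_add_tsum_nat_add (k + 1), Finset.sum_range_succ, hUk]
      have e1 : ‖∑ j ∈ Finset.range k, U j (y k) (t k)‖ ≤ 1 / 3 * 4 ^ k := by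
        refine (norm_sum_le _ _).trans ((Finset.sum_le_sum (fun j _ => hUb j (y k) (t k))).trans ?_)
        rw [geom_sum_eq (by norm_num)]
        have : (0:ℝ) < 4 ^ k := by positivity
        linarith
      have e2 : ‖∑' j, U (j + (k + 1)) (y k) (t k)‖ ≤ 2 := by
        apply tsum_of_norm_bounded hasSum_geometric_two
        intro j
        have hlt : k < j + (k + 1) := by omega
        refine (hUs (j + (k + 1)) (y k) (t k) ?_ (hδ2 _ k hlt)).trans ?_
        · have h6 := norm_sub_le (y k) (y (j + (k + 1)))
          have h7 : ‖y k‖ + ‖y (j + (k + 1))‖ ≤ ∑ i ∈ Finset.range (j + (k + 1) + 1), ‖y i‖ := by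
            rw [Finset.sum_range_succ]
            have := Finset.single_le_sum (f := fun j => ‖y j‖) (fun j _ => norm_nonneg _) (Finset.mem_range.2 hlt)
            linarith
          have h8 : (0:ℝ) ≤ ((j + (k + 1) : ℕ) : ℝ) := Nat.cast_nonneg _
          simp only [hKd]
          linarith
        · exact pow_le_pow_of_le_one (by norm_num) (by norm_num) (by omega)
      have e3 : ‖(4:ℂ) ^ k‖ = 4 ^ k := by simp
      set a := ∑ j ∈ Finset.range k, U j (y k) (t k)
      set b := ∑' j, U (j + (k + 1)) (y k) (t k)
      have e4 : ‖(4:ℂ) ^ k‖ ≤ ‖a + 4 ^ k + b‖ + ‖a‖ + ‖b‖ := by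
        calc ‖(4:ℂ) ^ k‖ = ‖(a + 4 ^ k + b) - a - b‖ := by congr 1; ring
          _ ≤ _ := (norm_sub_le _ _).trans (add_le_add (norm_sub_le _ _) le_rfl)
      rw [e3] at e4
      linarith
    have hlowlim : Tendsto (fun k : ℕ => ‖C‖ * (2 / 3 * (4:ℝ) ^ k - 2)) atTop atTop := by
      apply Tendsto.const_mul_atTop hCpos
      apply tendsto_atTop_add_const_right
      apply Tendsto.const_mul_atTop (by norm_num)
      exact tendsto_pow_atTop_atTop_of_one_lt (by norm_num)
    have hγlim : Tendsto (fun k => γ (t k)) atTop (𝓝 0) := by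
      have h1 := hγ_cont 0 (mem_Ici.2 le_rfl)
      have h2 : Tendsto t atTop (𝓝[Ici 0] 0) :=
        tendsto_nhdsWithin_iff.2 ⟨htlim, Eventually.of_forall fun k => (ht0 k).le⟩
      have h3 := h1.tendsto.comp h2
      rw [hγ_zero] at h3
      exact h3
    rw [EReal.eq_top_iff_forall_lt]
    intro c
    refine lt_of_lt_of_le (EReal.coe_lt_coe_iff.2 (lt_add_one c)) ?_
    apply le_limsup_of_frequently_le'
    rw [frequently_inf_principal, frequently_iff]
    intro V hV
    rw [Metric.mem_nhds_iff] at hV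
    obtain ⟨ρ, hρ, hV⟩ := hV
    have v1 := hγlim.eventually (gt_mem_nhds hρ)
    have v2 := htlim.eventually (gt_mem_nhds hρ)
    have v3 := hlowlim.eventually (eventually_ge_atTop (c + 1))
    obtain ⟨k, hk, a1, a2, a3⟩ := ((hhit x).and_eventually (v1.and (v2.and v3))).exists
    refine ⟨(y k, t k), hV ?_, ⟨hk, ht0 k⟩, ?_⟩
    · rw [mem_ball, Prod.dist_eq, max_lt_iff]
      constructor
      · rw [dist_eq_norm]; exact hk.trans a1
      · rw [Real.dist_0_eq_abs, abs_of_pos (ht0 k)]; exact a2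
    · rw [EReal.coe_le_coe_iff]
      exact a3.trans (hlow k)
end

section
/- Let 0 < B < 1, β > 0, K ≥ 0, λ > 0, and 2 ≤ a < b. Let F : [a,b] → ℝ be continuously differentiable with F' continuously differentiable and non-vanishing on [a,b], and assume |F'(r)| ≥ λ and |F''(r)| ≤ K r^{-β} |F'(r)|² for all r ∈ [a,b]. Then |∫_a^b e^{iF(r)} r^{-1}(log r)^{-B} dr| ≤ C (1/(aλ) + K/(β a^β)), where C depends only on B. -/
open MeasureTheory Filter Metric Set intervalIntegral
open scoped Topology ENNReal

/-- Non-stationary phase estimate via integration by parts: if `|F'| ≥ λ` and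
`|F''| ≤ K r^{-β} |F'|²` on `[a,b]` with `a ≥ 2`, then
`|∫_a^b e^{iF(r)} r^{-1}(log r)^{-B} dr| ≤ C (1/(aλ) + K/(β a^β))`,
where `C` depends only on `B`. -/
theorem nonstationary_phase_bound (B : ℝ) (hB0 : 0 < B) (hB1 : B < 1) :
    ∃ C : ℝ, 0 < C ∧
      ∀ (β K lam a b : ℝ) (F F' F'' : ℝ → ℝ),
        0 < β → 0 ≤ K → 0 < lam → 2 ≤ a → a < b →
        (∀ r ∈ Set.Icc a b, HasDerivAt F (F' r) r) →
        (∀ r ∈ Set.Icc a b, HasDerivAt F' (F'' r) r) →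
        ContinuousOn F'' (Set.Icc a b) →
        (∀ r ∈ Set.Icc a b, F' r ≠ 0) →
        (∀ r ∈ Set.Icc a b, lam ≤ |F' r|) →
        (∀ r ∈ Set.Icc a b, |F'' r| ≤ K * r ^ (-β) * (F' r) ^ 2) →
        ‖∫ r in a..b,
            Complex.exp (Complex.I * (F r : ℝ)) * (((Real.log r) ^ (-B) / r : ℝ) : ℂ)‖ ≤
          C * (1 / (a * lam) + K / (β * a ^ β)) := by
  have hl2 : 0 < Real.log 2 := Real.log_pos (by norm_num)
  have hM : 0 < (Real.log 2) ^ (-B) := Real.rpow_pos_of_pos hl2 _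
  set M := (Real.log 2) ^ (-B) with hMdef
  refine ⟨2 * M, by positivity, ?_⟩
  intro β K lam a b F F' F'' hβ hK hlam ha hab hF hF' hF''c hne hlow hup
  obtain ⟨w, hw⟩ : ∃ w : ℝ → ℝ, w = fun r => (Real.log r) ^ (-B) / r := ⟨_, rfl⟩
  obtain ⟨w1, hw1⟩ : ∃ w1 : ℝ → ℝ, w1 = fun r =>
    -(B * (Real.log r) ^ (-B - 1) + (Real.log r) ^ (-B)) / r ^ 2 := ⟨_, rfl⟩
  have hpos : ∀ r ∈ Set.Icc a b, 0 < r := fun r hr => by linarith [hr.1]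
  have hlog : ∀ r ∈ Set.Icc a b, 0 < Real.log r := fun r hr =>
    Real.log_pos (by linarith [hr.1])
  have hwd : ∀ r ∈ Set.Icc a b, HasDerivAt w (w1 r) r := by
    intro r hr
    have h0 := hpos r hr
    have h1 := hlog r hr
    have h := (((Real.hasDerivAt_log h0.ne').rpow_const (p := -B) (Or.inl h1.ne')).div
      (hasDerivAt_id r) h0.ne')
    rw [hw, hw1]
    refine HasDerivAt.congr_deriv (f := fun r => (Real.log r) ^ (-B) / r) h ?_
    simp only [id]
    field_simp
    ring
  have hw1neg : ∀ r ∈ Set.Icc a b, w1 r ≤ 0 := by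
    intro r hr
    have h0 := hpos r hr
    have h1 := hlog r hr
    rw [hw1]
    have h2 := Real.rpow_pos_of_pos h1 (-B)
    have h3 := Real.rpow_pos_of_pos h1 (-B - 1)
    have : 0 ≤ (B * (Real.log r) ^ (-B - 1) + (Real.log r) ^ (-B)) / r ^ 2 := by positivity
    simp only [neg_div]
    linarith
  have hwpos : ∀ r ∈ Set.Icc a b, 0 < w r := by
    intro r hr
    rw [hw]
    exact div_pos (Real.rpow_pos_of_pos (hlog r hr) _) (hpos r hr)
  have hwle : ∀ r ∈ Set.Icc a b, w r ≤ M / r := by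
    intro r hr
    rw [hw]
    have h0 := hpos r hr
    refine div_le_div_of_nonneg_right ?_ h0.le
    exact Real.rpow_le_rpow_of_nonpos hl2
      (Real.log_le_log (by norm_num) (by linarith [hr.1])) (by linarith)
  have hFc : ContinuousOn F (Set.Icc a b) := fun r hr => (hF r hr).continuousAt.continuousWithinAt
  have hF'c : ContinuousOn F' (Set.Icc a b) :=
    fun r hr => (hF' r hr).continuousAt.continuousWithinAt
  have hwc : ContinuousOn w (Set.Icc a b) :=
    fun r hr => (hwd r hr).continuousAt.continuousWithinAt
  have hlogc : ContinuousOn Real.log (Set.Icc a b) :=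
    fun r hr => (Real.continuousAt_log (hpos r hr).ne').continuousWithinAt
  have hw1c : ContinuousOn w1 (Set.Icc a b) := by
    rw [hw1]
    refine ContinuousOn.div (ContinuousOn.neg (ContinuousOn.add (continuousOn_const.mul ?_) ?_))
      (by fun_prop) (fun r hr => (pow_pos (hpos r hr) 2).ne')
    · exact hlogc.rpow_const (fun r hr => Or.inl (hlog r hr).ne')
    · exact hlogc.rpow_const (fun r hr => Or.inl (hlog r hr).ne')
  obtain ⟨u1, hu1⟩ : ∃ u1 : ℝ → ℝ, u1 = fun r =>
    (w1 r * F' r - w r * F'' r) / (F' r) ^ 2 := ⟨_, rfl⟩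
  have hu1c : ContinuousOn u1 (Set.Icc a b) := by
    rw [hu1]
    exact ((hw1c.mul hF'c).sub (hwc.mul hF''c)).div (hF'c.pow 2)
      (fun r hr => pow_ne_zero 2 (hne r hr))
  obtain ⟨v, hv⟩ : ∃ v : ℝ → ℂ, v = fun r => Complex.exp (Complex.I * (F r : ℝ)) := ⟨_, rfl⟩
  have hvd : ∀ r ∈ Set.Icc a b, HasDerivAt v (v r * (Complex.I * (F' r : ℂ))) r := by
    intro r hr
    rw [hv]
    exact ((hF r hr).ofReal_comp.const_mul Complex.I).cexp
  have hvc : ContinuousOn v (Set.Icc a b) :=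
    fun r hr => (hvd r hr).continuousAt.continuousWithinAt
  have hvn : ∀ r, ‖v r‖ = 1 := by
    intro r
    rw [hv]
    simp only [mul_comm Complex.I]
    exact Complex.norm_exp_ofReal_mul_I _
  obtain ⟨G, hG⟩ : ∃ G : ℝ → ℂ, G = fun r => -Complex.I * (((w r / F' r : ℝ) : ℂ) * v r) :=
    ⟨_, rfl⟩
  have hGd : ∀ r ∈ Set.Icc a b,
      HasDerivAt G (v r * (w r : ℂ) - Complex.I * ((u1 r : ℂ) * v r)) r := by
    intro r hr
    have h1 := ((hwd r hr).div (hF' r hr) (hne r hr)).ofReal_comp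
    have h2 := (h1.mul (hvd r hr)).const_mul (-Complex.I)
    rw [hG]
    refine HasDerivAt.congr_deriv (f := fun r => -Complex.I * (((w r / F' r : ℝ) : ℂ) * v r)) h2 ?_
    have h3 : (F' r : ℂ) ≠ 0 := by exact_mod_cast hne r hr
    rw [hu1]
    push_cast
    simp only [Pi.div_apply]
    push_cast
    field_simp
    ring_nf
    simp only [Complex.I_sq]
    ring
  have huI : Set.uIcc a b = Set.Icc a b := Set.uIcc_of_le hab.le
  have hwcC : ContinuousOn (fun r => (w r : ℂ)) (Set.Icc a b) :=
    Complex.continuous_ofReal.comp_continuousOn hwc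
  have hu1cC : ContinuousOn (fun r => (u1 r : ℂ)) (Set.Icc a b) :=
    Complex.continuous_ofReal.comp_continuousOn hu1c
  have hi1 : IntervalIntegrable (fun r => v r * (w r : ℂ)) volume a b :=
    ContinuousOn.intervalIntegrable (by rw [huI]; exact hvc.mul hwcC)
  have hi2 : IntervalIntegrable (fun r => Complex.I * ((u1 r : ℂ) * v r)) volume a b :=
    ContinuousOn.intervalIntegrable
      (by rw [huI]; exact continuousOn_const.mul (hu1cC.mul hvc))
  have hFTC := integral_eq_sub_of_hasDerivAt (f := G) (a := a) (b := b)
    (by rw [huI]; exact hGd) (hi1.sub hi2)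
  rw [intervalIntegral.integral_sub hi1 hi2] at hFTC
  obtain ⟨H, hH⟩ : ∃ H : ℝ → ℝ, H = fun r => -(w r / lam) - M * K / β * r ^ (-β) := ⟨_, rfl⟩
  obtain ⟨H1, hH1⟩ : ∃ H1 : ℝ → ℝ, H1 = fun r => -(w1 r / lam) + M * K * r ^ (-β - 1) :=
    ⟨_, rfl⟩
  have hHd : ∀ r ∈ Set.Icc a b, HasDerivAt H (H1 r) r := by
    intro r hr
    have h := ((hwd r hr).div_const lam).neg.sub
      ((Real.hasDerivAt_rpow_const (p := -β) (Or.inl (hpos r hr).ne')).const_mul (M * K / β))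
    rw [hH, hH1]
    refine HasDerivAt.congr_deriv (f := fun r => -(w r / lam) - M * K / β * r ^ (-β)) h ?_
    field_simp
    ring
  have hH1c : ContinuousOn H1 (Set.Icc a b) := by
    rw [hH1]
    exact (hw1c.div_const lam).neg.add (continuousOn_const.mul
      (continuousOn_id.rpow_const (fun r hr => Or.inl (hpos r hr).ne')))
  have hi3 : IntervalIntegrable H1 volume a b :=
    ContinuousOn.intervalIntegrable (by rw [huI]; exact hH1c)
  have hFTC2 := integral_eq_sub_of_hasDerivAt (f := H) (a := a) (b := b)
    (by rw [huI]; exact hHd) hi3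
  have hbd : ∀ r ∈ Set.Icc a b, |u1 r| ≤ H1 r := by
    intro r hr
    have h0 := hpos r hr
    have hf := abs_pos.mpr (hne r hr)
    have e : u1 r = w1 r / F' r - w r * (F'' r / (F' r) ^ 2) := by
      rw [hu1]
      have := hne r hr
      field_simp
    have h1 : |w1 r / F' r| ≤ -(w1 r / lam) := by
      rw [abs_div, abs_of_nonpos (hw1neg r hr), ← neg_div]
      exact div_le_div_of_nonneg_left (by linarith [hw1neg r hr]) hlam (hlow r hr)
    have h2 : |F'' r / (F' r) ^ 2| ≤ K * r ^ (-β) := by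
      rw [abs_div, abs_of_nonneg (sq_nonneg (F' r)),
        div_le_iff₀ (by have := hne r hr; positivity)]
      exact hup r hr
    have h3 : |w r * (F'' r / (F' r) ^ 2)| ≤ M * K * r ^ (-β - 1) := by
      rw [abs_mul, abs_of_pos (hwpos r hr)]
      calc w r * |F'' r / (F' r) ^ 2| ≤ M / r * (K * r ^ (-β)) :=
            mul_le_mul (hwle r hr) h2 (abs_nonneg _) (by positivity)
        _ = M * K * r ^ (-β - 1) := by
            rw [Real.rpow_sub_one h0.ne']; ring
    rw [e, hH1]
    exact (abs_sub _ _).trans (add_le_add h1 h3)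
  have hI2 : ‖∫ r in a..b, Complex.I * ((u1 r : ℂ) * v r)‖ ≤ H b - H a := by
    rw [← hFTC2]
    refine intervalIntegral.norm_integral_le_of_norm_le hab.le ?_ hi3
    refine Filter.Eventually.of_forall (fun r hr => ?_)
    rw [norm_mul, norm_mul, hvn, Complex.norm_I, one_mul, mul_one, Complex.norm_real]
    exact hbd r (Set.Ioc_subset_Icc_self hr)
  have hGn : ∀ r ∈ Set.Icc a b, ‖G r‖ ≤ w r / lam := by
    intro r hr
    rw [hG]
    simp only [norm_mul, norm_neg, hvn, Complex.norm_I, one_mul, mul_one, Complex.norm_real]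
    rw [Real.norm_eq_abs, abs_div, abs_of_pos (hwpos r hr)]
    exact div_le_div_of_nonneg_left (hwpos r hr).le hlam (hlow r hr)
  have hA : a ∈ Set.Icc a b := ⟨le_rfl, hab.le⟩
  have hBb : b ∈ Set.Icc a b := ⟨hab.le, le_rfl⟩
  have hgoal : (∫ r in a..b,
      Complex.exp (Complex.I * (F r : ℝ)) * (((Real.log r) ^ (-B) / r : ℝ) : ℂ))
      = (G b - G a) + ∫ r in a..b, Complex.I * ((u1 r : ℂ) * v r) := by
    rw [← hFTC, hv, hw]
    ring
  rw [hgoal]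
  have h1 := norm_add_le (G b - G a) (∫ r in a..b, Complex.I * ((u1 r : ℂ) * v r))
  have h2 := norm_sub_le (G b) (G a)
  have h3 := hGn a hA
  have h4 := hGn b hBb
  have h0 := hpos a hA
  have h5 : w a / lam ≤ M * (1 / (a * lam)) := by
    calc w a / lam ≤ M / a / lam := div_le_div_of_nonneg_right (hwle a hA) hlam.le
      _ = _ := by field_simp
  have h6 : M * K / β * a ^ (-β) = M * (K / (β * a ^ β)) := by
    rw [Real.rpow_neg h0.le]
    field_simp
  have h7 : 0 ≤ M * K / β * b ^ (-β) := by
    have := Real.rpow_pos_of_pos (hpos b hBb) (-β)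
    positivity
  have h8 : 0 ≤ M * (K / (β * a ^ β)) := by
    have := Real.rpow_pos_of_pos h0 β
    positivity
  rw [hH] at hI2
  simp only at hI2
  rw [h6] at hI2
  linarith
end

section
/- Let d_1, d_2 ≥ 1, d = d_1 + d_2, p, q ∈ (1,∞), and let ρ ∈ (0,1) and k ∈ (0,1) satisfy 1/p < ρk < 1 and 1/q < ρ(1−k) < 1. Let μ > 2, let (Ω_j)_{j∈ℕ} be pairwise disjoint open subsets of ℝ^d \ B_μ(0), let b_j ∈ L¹_loc(ℝ^d) satisfy sup_{j∈ℕ} ‖b_j‖_{L^∞(Ω_j)} < ∞, let χ_j be the characteristic function of Ω_j, and define h(ξ) = |ξ|^{-d} (log|ξ|)^{-ρ} Σ_{j=1}^∞ χ_j(ξ) b_j(ξ). Then, with s_1 = d_1(p−1)/p and s_2 = d_2(q−1)/q, ∫_{ℝ^{d_2}} ⟨ξ_2⟩^{s_2 q} ( ∫_{ℝ^{d_1}} ⟨ξ_1⟩^{s_1 p} |h(ξ_1,ξ_2)|^p dξ_1 )^{q/p} dξ_2 < ∞; that is, the function g with ĝ = h belongs to the mixed Fourier Lebesgue space 𝓕L^{p,q}_{s_1,s_2}(ℝ^{d_1}×ℝ^{d_2}).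 -/
open MeasureTheory Filter Metric Set
open scoped Topology ENNReal

lemma aux_mp (d₁ d₂ : ℕ) : MeasurePreserving
    (fun z : EuclideanSpace ℝ (Fin d₂) × EuclideanSpace ℝ (Fin d₁) =>
      (WithLp.toLp 2 (Fin.append z.2 z.1) : EuclideanSpace ℝ (Fin (d₁ + d₂))))
    (volume.prod volume) volume := by
  have h1 := Measure.measurePreserving_swap
    (μ := (volume : Measure (EuclideanSpace ℝ (Fin d₂))))
    (ν := (volume : Measure (EuclideanSpace ℝ (Fin d₁))))
  have h2 := (PiLp.volume_preserving_ofLp (Fin d₁)).prod (PiLp.volume_preserving_ofLp (Fin d₂))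
  have h3 := volume_measurePreserving_sumPiEquivProdPi_symm (fun _ : Fin d₁ ⊕ Fin d₂ => ℝ)
  have h4 := volume_measurePreserving_piCongrLeft (fun _ : Fin (d₁ + d₂) => ℝ) finSumFinEquiv
  have h5 := PiLp.volume_preserving_toLp (Fin (d₁ + d₂))
  have h6 := h5.comp (h4.comp (h3.comp (h2.comp h1)))
  refine Eq.mp ?_ h6
  congr 1
  funext z
  simp only [Function.comp]
  congr 1
  funext i
  obtain ⟨j, rfl⟩ := finSumFinEquiv.surjective i
  rw [MeasurableEquiv.piCongrLeft_apply_apply]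
  rcases j with j | j <;> simp [MeasurableEquiv.sumPiEquivProdPi, Equiv.sumPiEquivProdPi]

lemma aux_norm (d₁ d₂ : ℕ) (x : EuclideanSpace ℝ (Fin d₁)) (y : EuclideanSpace ℝ (Fin d₂)) :
    ‖(WithLp.toLp 2 (Fin.append x y) : EuclideanSpace ℝ (Fin (d₁ + d₂)))‖ ^ 2
      = ‖x‖ ^ 2 + ‖y‖ ^ 2 := by
  simp only [EuclideanSpace.real_norm_sq_eq]
  rw [Fin.sum_univ_add]
  simp

lemma aux_int1 (a : ℝ) (ha : 1 < a) :
    IntegrableOn (fun r : ℝ => (2 + r)⁻¹ * (Real.log (2 + r)) ^ (-a)) (Ioi 0) := by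
  have hpos : ∀ r : ℝ, 0 ≤ r → 0 < Real.log (2 + r) := fun r hr => Real.log_pos (by linarith)
  have key : IntegrableOn (fun r : ℝ => (2 + r)⁻¹ * (1 - a) * (Real.log (2 + r)) ^ (1 - a - 1))
      (Ioi 0) := by
    refine integrableOn_Ioi_deriv_of_nonpos' (g := fun r => (Real.log (2 + r)) ^ (1 - a)) (l := 0)
      ?_ ?_ ?_
    · intro r hr
      have h0 : HasDerivAt (fun r : ℝ => Real.log (2 + r)) ((2 + r)⁻¹) r := by
        have := ((hasDerivAt_id r).const_add 2).log (by have : (0:ℝ) ≤ r := hr; simp; linarith)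
        simpa using this
      exact h0.rpow_const (Or.inl (hpos r hr).ne')
    · intro r hr
      have hr' : (0:ℝ) < r := hr
      have h1 := Real.rpow_nonneg (hpos r hr'.le).le (1 - a - 1)
      have h2 : (0:ℝ) ≤ (2 + r)⁻¹ := by positivity
      have : (2 + r)⁻¹ * (1 - a) ≤ 0 := mul_nonpos_of_nonneg_of_nonpos h2 (by linarith)
      exact mul_nonpos_of_nonpos_of_nonneg this h1
    · have h1 : Tendsto (fun r : ℝ => Real.log (2 + r)) atTop atTop :=
        Real.tendsto_log_atTop.comp (tendsto_atTop_add_const_left _ _ tendsto_id)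
      have := (tendsto_rpow_neg_atTop (y := a - 1) (by linarith)).comp h1
      simpa [Function.comp_def] using this
  have := key.const_mul (1 - a)⁻¹
  refine this.congr (ae_of_all _ fun r => ?_)
  have : 1 - a ≠ 0 := by linarith
  have e : (1 - a - 1) = -a := by ring
  simp only [e]
  field_simp

lemma aux_sq {a b : ℝ} (hab : a ^ 2 ≤ b ^ 2) (hb : 0 ≤ b) : a ≤ b :=
  (le_abs_self a).trans (abs_le_of_sq_le_sq hab hb)

noncomputable def GG (d : ℕ) (a t : ℝ) : ℝ :=
  (1 + t ^ 2) ^ (-(d : ℝ) / 2) * (Real.log (2 + t)) ^ (-a)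

lemma GG_nonneg (d : ℕ) (a t : ℝ) (ht : 0 ≤ t) : 0 ≤ GG d a t := by
  have : 0 < Real.log (2 + t) := Real.log_pos (by linarith)
  unfold GG
  positivity

lemma GG_meas (d : ℕ) (a : ℝ) : Measurable (GG d a) := by
  unfold GG
  fun_prop

lemma aux_int (d : ℕ) (hd : 1 ≤ d) (a : ℝ) (ha : 1 < a) :
    Integrable (fun x : EuclideanSpace ℝ (Fin d) => GG d a ‖x‖) := by
  have : Nonempty (Fin d) := ⟨⟨0, hd⟩⟩
  rw [integrable_fun_norm_addHaar (μ := volume) (f := GG d a)]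
  refine Integrable.mono' ((aux_int1 a ha).const_mul 3) ?_ ?_
  · exact ((measurable_id.pow_const _).smul (GG_meas d a)).aestronglyMeasurable
  · refine (ae_restrict_iff' measurableSet_Ioi).2 (ae_of_all _ fun r hr => ?_)
    have hr' : (0:ℝ) < r := hr
    have hL : 0 < Real.log (2 + r) := Real.log_pos (by linarith)
    rw [finrank_euclideanSpace, Fintype.card_fin, smul_eq_mul, Real.norm_of_nonneg
      (mul_nonneg (by positivity) (GG_nonneg d a r hr'.le))]
    unfold GG
    rw [← mul_assoc, ← mul_assoc]
    refine mul_le_mul_of_nonneg_right ?_ (by positivity)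
    have hs : (1 + r^2 : ℝ) ^ (-(d:ℝ)/2) = (Real.sqrt (1 + r^2) ^ d)⁻¹ := by
      rw [Real.sqrt_eq_rpow, ← Real.rpow_natCast _ d, ← Real.rpow_mul (by positivity),
        ← Real.rpow_neg (by positivity)]
      congr 1; ring
    rw [hs]
    obtain ⟨n, rfl⟩ : ∃ n, d = n + 1 := ⟨d - 1, by omega⟩
    set s := Real.sqrt (1 + r^2) with hsdef
    have hs2 : s ^ 2 = 1 + r ^ 2 := Real.sq_sqrt (by positivity)
    have hs0 : 0 < s := Real.sqrt_pos.2 (by positivity)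
    have h1 : r ≤ s := Real.le_sqrt_of_sq_le (by linarith)
    have h2 : 2 + r ≤ 3 * s := by nlinarith
    have h3 : r ^ n ≤ s ^ n := by gcongr
    simp only [Nat.add_sub_cancel]
    rw [← div_eq_mul_inv, ← div_eq_mul_inv, div_le_div_iff₀ (by positivity) (by positivity), pow_succ]
    calc r ^ n * (2 + r) ≤ s ^ n * (3 * s) := by gcongr
      _ = _ := by ring

lemma aux_pt (d : ℕ) (a r t : ℝ) (ha : 0 < a) (ht : 0 ≤ t) (htr : t ≤ r) (hr : 2 ≤ r) :
    r ^ (-(d:ℝ)) * (Real.log r) ^ (-a) ≤ (2 ^ ((d:ℝ)/2) * 2 ^ a) * GG d a t := by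
  have hL : 0 < Real.log (2 + t) := Real.log_pos (by linarith)
  have h1 : r ^ (-(d:ℝ)) ≤ 2 ^ ((d:ℝ)/2) * (1 + t^2) ^ (-(d:ℝ)/2) := by
    have e : r ^ (-(d:ℝ)) = (r^2) ^ (-(d:ℝ)/2) := by
      rw [← Real.rpow_natCast r 2, ← Real.rpow_mul (by linarith)]
      congr 1; push_cast; ring
    have e2 : (2:ℝ) ^ ((d:ℝ)/2) * (1 + t^2) ^ (-(d:ℝ)/2) = ((1 + t^2)/2) ^ (-(d:ℝ)/2) := by
      rw [Real.div_rpow (by positivity) (by norm_num), neg_div, Real.rpow_neg (by norm_num : (0:ℝ) ≤ 2), div_inv_eq_mul,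
        mul_comm]
    rw [e, e2]
    refine Real.rpow_le_rpow_of_nonpos (by positivity) (by nlinarith) ?_
    have : (0:ℝ) ≤ d := by positivity
    linarith
  have h2 : (Real.log r) ^ (-a) ≤ 2 ^ a * (Real.log (2 + t)) ^ (-a) := by
    have e2 : (2:ℝ) ^ a * (Real.log (2 + t)) ^ (-a) = (Real.log (2 + t) / 2) ^ (-a) := by
      rw [Real.div_rpow hL.le (by norm_num), Real.rpow_neg (by norm_num : (0:ℝ) ≤ 2), div_inv_eq_mul, mul_comm]
    rw [e2]
    refine Real.rpow_le_rpow_of_nonpos (by positivity) ?_ (by linarith)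
    have : Real.log (2 + t) ≤ Real.log (r ^ 2) := Real.log_le_log (by linarith) (by nlinarith)
    rw [Real.log_pow] at this
    push_cast at this
    linarith
  have h3 : 0 ≤ Real.log r := Real.log_nonneg (by linarith)
  have hr0 : 0 ≤ r := by linarith
  calc _ ≤ (2 ^ ((d:ℝ)/2) * (1 + t^2) ^ (-(d:ℝ)/2)) * (2 ^ a * (Real.log (2 + t)) ^ (-a)) := by
        gcongr
    _ = _ := by unfold GG; ring

lemma aux_wt (d : ℕ) (a p t : ℝ) (ht : 0 ≤ t) (s : ℝ) (hs : s = d * (p - 1) / p) (hp : 1 < p) :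
    (1 + t ^ 2) ^ (s * p / 2) * GG d a t ^ p = GG d (a * p) t := by
  have hL : 0 < Real.log (2 + t) := Real.log_pos (by linarith)
  unfold GG
  rw [Real.mul_rpow (by positivity) (by positivity), ← Real.rpow_mul (by positivity),
    ← Real.rpow_mul hL.le, ← mul_assoc, ← Real.rpow_add (by positivity)]
  have : p ≠ 0 := by linarith
  congr 2
  · rw [hs]; field_simp; ring
  · ring

/-- Mixed-norm membership lemma: under the stated conditions on `ρ`, `k`, the function
with Fourier transform `h(ξ) = |ξ|^{-d} (log|ξ|)^{-ρ} Σ_j χ_j(ξ) b_j(ξ)` belongs to the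
mixed Fourier Lebesgue space `𝓕L^{p,q}_{s₁,s₂}(ℝ^{d₁}×ℝ^{d₂})`, where
`s₁ = d₁(p-1)/p` and `s₂ = d₂(q-1)/q`. -/
theorem membership_mixed_FLpq
    (d₁ d₂ : ℕ) (hd₁ : 1 ≤ d₁) (hd₂ : 1 ≤ d₂)
    (p q ρ k : ℝ) (hp : 1 < p) (hq : 1 < q)
    (hρ0 : 0 < ρ) (hρ1 : ρ < 1) (hk0 : 0 < k) (hk1 : k < 1)
    (hpk : 1 / p < ρ * k) (hpk1 : ρ * k < 1)
    (hqk : 1 / q < ρ * (1 - k)) (hqk1 : ρ * (1 - k) < 1)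
    (μ : ℝ) (hμ : 2 < μ)
    (Ω : ℕ → Set (EuclideanSpace ℝ (Fin (d₁ + d₂))))
    (hΩ_open : ∀ j, IsOpen (Ω j))
    (hΩ_disj : Pairwise (Function.onFun Disjoint Ω))
    (hΩ_sub : ∀ j, Ω j ⊆ (Metric.ball (0 : EuclideanSpace ℝ (Fin (d₁ + d₂))) μ)ᶜ)
    (b : ℕ → EuclideanSpace ℝ (Fin (d₁ + d₂)) → ℂ)
    (hb_loc : ∀ j, LocallyIntegrable (b j) volume)
    (hb_bdd : ∃ M : ℝ, ∀ j,
      ∀ᵐ ξ ∂(volume : Measure (EuclideanSpace ℝ (Fin (d₁ + d₂)))),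
        ξ ∈ Ω j → ‖b j ξ‖ ≤ M)
    (h : EuclideanSpace ℝ (Fin (d₁ + d₂)) → ℂ)
    (hh : ∀ ξ, h ξ = (‖ξ‖ ^ (-((d₁ + d₂ : ℕ) : ℝ)) * (Real.log ‖ξ‖) ^ (-ρ)) •
      ∑' j, Set.indicator (Ω j) (b j) ξ)
    (s₁ s₂ : ℝ) (hs₁ : s₁ = d₁ * (p - 1) / p) (hs₂ : s₂ = d₂ * (q - 1) / q) :
    (∫⁻ ξ₂ : EuclideanSpace ℝ (Fin d₂),
        ENNReal.ofReal ((1 + ‖ξ₂‖ ^ 2) ^ (s₂ * q / 2)) *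
          (∫⁻ ξ₁ : EuclideanSpace ℝ (Fin d₁),
            ENNReal.ofReal ((1 + ‖ξ₁‖ ^ 2) ^ (s₁ * p / 2) *
              ‖h (WithLp.toLp 2 (Fin.append ξ₁ ξ₂) : EuclideanSpace ℝ (Fin (d₁ + d₂)))‖ ^ p)) ^ (q / p))
      < ⊤ := by
  obtain ⟨M, hM⟩ := hb_bdd
  have hρk : 0 < ρ * k := by positivity
  have hρk' : 0 < ρ * (1 - k) := mul_pos hρ0 (by linarith)
  have hp0 : 0 < p := by linarith
  have hq0 : 0 < q := by linarith
  set C : ℝ := |M| * ((2 ^ ((d₁:ℝ)/2) * 2 ^ (ρ * k)) * (2 ^ ((d₂:ℝ)/2) * 2 ^ (ρ * (1 - k)))) with hC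
  have hC0 : 0 ≤ C := by positivity
  have hae : ∀ᵐ ξ ∂(volume : Measure (EuclideanSpace ℝ (Fin (d₁ + d₂)))),
      ∀ t₁ t₂ : ℝ, 0 ≤ t₁ → t₁ ≤ ‖ξ‖ → 0 ≤ t₂ → t₂ ≤ ‖ξ‖ →
        ‖h ξ‖ ≤ C * (GG d₁ (ρ * k) t₁ * GG d₂ (ρ * (1 - k)) t₂) := by
    filter_upwards [ae_all_iff.2 hM] with ξ hξ t₁ t₂ h1 h1' h2 h2'
    have g1 := GG_nonneg d₁ (ρ * k) t₁ h1
    have g2 := GG_nonneg d₂ (ρ * (1 - k)) t₂ h2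
    rw [hh]
    by_cases hj : ∃ j, ξ ∈ Ω j
    · obtain ⟨j, hj⟩ := hj
      have hsum : ∑' i, Set.indicator (Ω i) (b i) ξ = b j ξ := by
        rw [tsum_eq_single j, Set.indicator_of_mem hj]
        intro i hi
        refine Set.indicator_of_notMem (fun hi' => ?_) _
        exact (Set.disjoint_left.1 (hΩ_disj hi)) hi' hj
      have hr : 2 ≤ ‖ξ‖ := by
        have := hΩ_sub j hj
        simp at this
        linarith
      have hlog : 0 < Real.log ‖ξ‖ := Real.log_pos (by linarith)
      have hr0 : 0 < ‖ξ‖ := by linarith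
      have hb : ‖b j ξ‖ ≤ |M| := (hξ j hj).trans (le_abs_self M)
      rw [hsum, norm_smul, Real.norm_of_nonneg (by positivity)]
      have e : ‖ξ‖ ^ (-((d₁ + d₂ : ℕ) : ℝ)) * (Real.log ‖ξ‖) ^ (-ρ) =
          (‖ξ‖ ^ (-(d₁:ℝ)) * (Real.log ‖ξ‖) ^ (-(ρ * k))) *
          (‖ξ‖ ^ (-(d₂:ℝ)) * (Real.log ‖ξ‖) ^ (-(ρ * (1 - k)))) := by
        rw [mul_mul_mul_comm, ← Real.rpow_add hr0, ← Real.rpow_add hlog]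
        congr 2
        · push_cast; ring
        · ring
      rw [e]
      calc _ ≤ (((2 ^ ((d₁:ℝ)/2) * 2 ^ (ρ * k)) * GG d₁ (ρ * k) t₁) *
            ((2 ^ ((d₂:ℝ)/2) * 2 ^ (ρ * (1 - k))) * GG d₂ (ρ * (1 - k)) t₂)) * |M| := by
            have A1 := aux_pt d₁ (ρ * k) ‖ξ‖ t₁ hρk h1 h1' hr
            have A2 := aux_pt d₂ (ρ * (1 - k)) ‖ξ‖ t₂ hρk' h2 h2' hr
            exact mul_le_mul (mul_le_mul A1 A2 (by positivity) (by positivity)) hb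
              (norm_nonneg _) (by positivity)
        _ = _ := by rw [hC]; ring
    · have hsum : ∑' i, Set.indicator (Ω i) (b i) ξ = 0 := by
        have : ∀ i, Set.indicator (Ω i) (b i) ξ = 0 := fun i =>
          Set.indicator_of_notMem (fun hi => hj ⟨i, hi⟩) _
        simp [this]
      rw [hsum, smul_zero, norm_zero]
      positivity
  have hae2 := Measure.ae_ae_of_ae_prod ((aux_mp d₁ d₂).quasiMeasurePreserving.ae hae)
  set I : ℝ≥0∞ := ∫⁻ x : EuclideanSpace ℝ (Fin d₁), ENNReal.ofReal (GG d₁ (ρ * k * p) ‖x‖) with hI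
  have ha1 : 1 < ρ * k * p := by rwa [div_lt_iff₀ hp0] at hpk
  have ha2 : 1 < ρ * (1 - k) * q := by rwa [div_lt_iff₀ hq0] at hqk
  have hIfin : I < ⊤ := (aux_int d₁ hd₁ _ ha1).lintegral_lt_top
  have hJfin : (∫⁻ x : EuclideanSpace ℝ (Fin d₂), ENNReal.ofReal (GG d₂ (ρ * (1 - k) * q) ‖x‖)) < ⊤ :=
    (aux_int d₂ hd₂ _ ha2).lintegral_lt_top
  have hbound : ∀ᵐ y : EuclideanSpace ℝ (Fin d₂),
      ENNReal.ofReal ((1 + ‖y‖ ^ 2) ^ (s₂ * q / 2)) *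
          (∫⁻ x : EuclideanSpace ℝ (Fin d₁),
            ENNReal.ofReal ((1 + ‖x‖ ^ 2) ^ (s₁ * p / 2) *
              ‖h (WithLp.toLp 2 (Fin.append x y) : EuclideanSpace ℝ (Fin (d₁ + d₂)))‖ ^ p)) ^ (q / p)
      ≤ (ENNReal.ofReal (C ^ q) * I ^ (q / p)) *
          ENNReal.ofReal (GG d₂ (ρ * (1 - k) * q) ‖y‖) := by
    filter_upwards [hae2] with y hy
    have g2 := GG_nonneg d₂ (ρ * (1 - k)) ‖y‖ (norm_nonneg _)
    have hin : (∫⁻ x : EuclideanSpace ℝ (Fin d₁),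
            ENNReal.ofReal ((1 + ‖x‖ ^ 2) ^ (s₁ * p / 2) *
              ‖h (WithLp.toLp 2 (Fin.append x y) : EuclideanSpace ℝ (Fin (d₁ + d₂)))‖ ^ p))
        ≤ ENNReal.ofReal ((C * GG d₂ (ρ * (1 - k)) ‖y‖) ^ p) * I := by
      rw [hI, ← lintegral_const_mul' _ _ ENNReal.ofReal_ne_top]
      refine lintegral_mono_ae ?_
      filter_upwards [hy] with x hx
      have g1 := GG_nonneg d₁ (ρ * k) ‖x‖ (norm_nonneg _)
      rw [← ENNReal.ofReal_mul (by positivity)]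
      refine ENNReal.ofReal_le_ofReal ?_
      have hn := aux_norm d₁ d₂ x y
      have hx' := hx ‖x‖ ‖y‖ (norm_nonneg _)
        (aux_sq (by rw [hn]; nlinarith [sq_nonneg ‖y‖]) (norm_nonneg _)) (norm_nonneg _)
        (aux_sq (by rw [hn]; nlinarith [sq_nonneg ‖x‖]) (norm_nonneg _))
      rw [← aux_wt d₁ (ρ * k) p ‖x‖ (norm_nonneg _) s₁ hs₁ hp]
      calc _ ≤ (1 + ‖x‖ ^ 2) ^ (s₁ * p / 2) *
            (C * (GG d₁ (ρ * k) ‖x‖ * GG d₂ (ρ * (1 - k)) ‖y‖)) ^ p := by gcongr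
        _ = (1 + ‖x‖ ^ 2) ^ (s₁ * p / 2) *
            ((C * GG d₂ (ρ * (1 - k)) ‖y‖) * GG d₁ (ρ * k) ‖x‖) ^ p := by congr 2; ring
        _ = _ := by rw [Real.mul_rpow (by positivity) g1]; ring
    calc _ ≤ ENNReal.ofReal ((1 + ‖y‖ ^ 2) ^ (s₂ * q / 2)) *
          (ENNReal.ofReal ((C * GG d₂ (ρ * (1 - k)) ‖y‖) ^ p) * I) ^ (q / p) := by gcongr
      _ = ENNReal.ofReal ((1 + ‖y‖ ^ 2) ^ (s₂ * q / 2)) *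
          (ENNReal.ofReal (C ^ q * GG d₂ (ρ * (1 - k)) ‖y‖ ^ q) * I ^ (q / p)) := by
          rw [ENNReal.mul_rpow_of_nonneg _ _ (by positivity),
            ENNReal.ofReal_rpow_of_nonneg (by positivity) (by positivity),
            ← Real.rpow_mul (by positivity), mul_div_cancel₀ _ hp0.ne',
            Real.mul_rpow hC0 g2]
      _ = _ := by
          rw [← aux_wt d₂ (ρ * (1 - k)) q ‖y‖ (norm_nonneg _) s₂ hs₂ hq,
            ENNReal.ofReal_mul (by positivity), ENNReal.ofReal_mul (by positivity)]
          ring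
  refine (lintegral_mono_ae hbound).trans_lt ?_
  have hc : ENNReal.ofReal (C ^ q) * I ^ (q / p) ≠ ⊤ :=
    ENNReal.mul_ne_top ENNReal.ofReal_ne_top
      (ENNReal.rpow_ne_top_of_nonneg (by positivity) hIfin.ne)
  rw [lintegral_const_mul' _ _ hc]
  exact ENNReal.mul_lt_top hc.lt_top hJfin
end
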